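/- The equation DΓ = X_H(Γ) has a nonzero formal solution Γ̂ ∈ 𝖳⁴[[τ⁻¹]] of the form Γ̂ = (τ⁻²Γ̂₁, τ⁻²Γ̂₂, τ⁻¹Γ̂₃, τ⁻¹Γ̂₄) with Γ̂ᵢ ∈ 𝖳[[τ⁻¹]], whose leading coefficients are Γ̂₁ = κ cos φ + O(τ⁻¹), Γ̂₂ = κ sin φ + O(τ⁻¹), Γ̂₃ = κ cos φ + O(τ⁻¹), Γ̂₄ = κ sin φ + O(τ⁻¹), where κ² = −2/η. Moreover, for any other nonzero formal solution Γ̃ of DΓ = X_H(Γ) of the same form there exists (φ₀, τ₀) ∈ ℂ² such that Γ̃(φ,τ) = Γ̂(φ+φ₀, τ+τ₀), where the translate is defined by substituting φ+φ₀ into the trigonometric coefficients and re-expanding (τ+τ₀)^{−k} by the binomial series. -/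

import Mathlib

noncomputable section
open Complex Filter Set MeasureTheory Matrix

abbrev C4 := Fin 4 → ℂ

def Jmat : Matrix (Fin 4) (Fin 4) ℂ :=
  !![0, 0, 1, 0;
     0, 0, 0, 1;
     -1, 0, 0, 0;
     0, -1, 0, 0]

def Om (x y : C4) : ℂ := dotProduct x (Jmat.mulVec y)

def gradC (H : C4 → ℂ) (x : C4) : C4 := fun i => fderiv ℂ H x (Pi.single i 1)

def XH (H : C4 → ℂ) (x : C4) : C4 := Jmat.mulVec (gradC H x)

def DXH (H : C4 → ℂ) (x : C4) : Matrix (Fin 4) (Fin 4) ℂ :=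
  Matrix.of fun i j => fderiv ℂ (fun y => XH H y i) x (Pi.single j 1)

def I1f (x : C4) : ℂ := x 1 * x 2 - x 0 * x 3
def I2f (x : C4) : ℂ := (x 0 ^ 2 + x 1 ^ 2) / 2
def I3f (x : C4) : ℂ := (x 2 ^ 2 + x 3 ^ 2) / 2

def wsize (x : C4) : ℝ :=
  max (max (‖x 0‖ ^ ((1:ℝ)/2)) (‖x 1‖ ^ ((1:ℝ)/2))) (max ‖x 2‖ ‖x 3‖)

structure HamData where
  η : ℂ
  hη : η ≠ 0
  dom : Set C4
  hopen : IsOpen dom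
  hzero : (0 : C4) ∈ dom
  F : C4 → ℂ
  hFan : AnalyticOnNhd ℂ F dom
  hFbd : ∃ M, ∀ x ∈ dom, ‖F x‖ ≤ M
  hFord : ∃ C, ∀ x ∈ dom, ‖F x‖ ≤ C * wsize x ^ (5:ℕ)

def Ham (d : HamData) : C4 → ℂ :=
  fun x => -(I1f x) + I2f x + d.η * (I3f x) ^ 2 + d.F x

def IsTrigPoly (f : ℂ → ℂ) : Prop :=
  ∃ (n : ℕ) (a b : ℕ → ℂ), ∀ φ : ℂ,
    f φ = a 0 + ∑ k ∈ Finset.Icc 1 n, (a k * Complex.cos (k * φ) + b k * Complex.sin (k * φ))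

def psOrd (N : ℕ) (i : Fin 4) : ℕ := if (i : ℕ) < 2 then N + 1 else N

def pSum (G : ℕ → ℂ → C4) (N : ℕ) (φ τ : ℂ) : C4 :=
  fun i => ∑ k ∈ Finset.range (psOrd N i + 1), G k φ i * τ ^ (-(k:ℤ))

def DopV (f : ℂ → ℂ → C4) (φ τ : ℂ) : C4 :=
  fun i => deriv (fun x => f x τ i) φ + deriv (fun x => f φ x i) τ

def IsFormalSol (Udom : Set C4) (H : C4 → ℂ) (G : ℕ → ℂ → C4) : Prop :=
  (∀ k i, IsTrigPoly (fun φ => G k φ i)) ∧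
  (∀ φ, G 0 φ = 0) ∧
  (∀ φ, G 1 φ 0 = 0 ∧ G 1 φ 1 = 0) ∧
  ∀ N : ℕ, ∃ C > (0:ℝ), ∃ T > (0:ℝ), ∀ φ t : ℝ, T ≤ t →
    pSum G N (φ:ℂ) (t:ℂ) ∈ Udom ∧
    ∀ i : Fin 4,
      ‖DopV (pSum G N) (φ:ℂ) (t:ℂ) i - XH H (pSum G N (φ:ℂ) (t:ℂ)) i‖
        ≤ C / t ^ (psOrd N i + 1)

def IsFormalSeparatrix (η : ℂ) (Udom : Set C4) (H : C4 → ℂ) (κ : ℂ)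
    (G : ℕ → ℂ → C4) : Prop :=
  κ ^ 2 = -2 / η ∧
  IsFormalSol Udom H G ∧
  (∀ φ : ℂ, G 2 φ 0 = κ * Complex.cos φ ∧ G 2 φ 1 = κ * Complex.sin φ ∧
            G 1 φ 2 = κ * Complex.cos φ ∧ G 1 φ 3 = κ * Complex.sin φ) ∧
  (∃ k φ, G k φ ≠ 0)

def shiftC (G : ℕ → ℂ → C4) (φ₀ τ₀ : ℂ) : ℕ → ℂ → C4 :=
  fun k φ => ∑ j ∈ Finset.range (k + 1),
    ((-1 : ℂ) ^ (k - j) * ((k-1).choose (k - j) : ℂ) * τ₀ ^ (k - j)) • G j (φ + φ₀)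


/-! ## Trigonometric polynomials as Laurent polynomials in `exp (I φ)` -/

abbrev LA := LaurentPolynomial ℂ

abbrev lT (n : ℤ) : LA := LaurentPolynomial.T n
abbrev lC (a : ℂ) : LA := LaurentPolynomial.C a

def evHom (φ : ℂ) : Multiplicative ℤ →* ℂ where
  toFun n := Complex.exp ((Multiplicative.toAdd n : ℤ) * (φ * I))
  map_one' := by simp
  map_mul' a b := by
    simp only [toAdd_mul, Int.cast_add, add_mul, Complex.exp_add]

def ev (φ : ℂ) : LA →ₐ[ℂ] ℂ := AddMonoidAlgebra.lift ℂ ℂ ℤ (evHom φ)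

lemma ev_CT (φ a : ℂ) (n : ℤ) :
    ev φ (LaurentPolynomial.C a * LaurentPolynomial.T n) = a * Complex.exp (n * (φ * I)) := by
  rw [← LaurentPolynomial.single_eq_C_mul_T, ev, AddMonoidAlgebra.lift_single]
  simp [evHom]

lemma ev_T (φ : ℂ) (n : ℤ) : ev φ (LaurentPolynomial.T n) = Complex.exp (n * (φ * I)) := by
  have := ev_CT φ 1 n
  simpa using this

lemma ev_C (φ a : ℂ) : ev φ (LaurentPolynomial.C a) = a := by
  have := ev_CT φ a 0
  simpa using this

def rotHom (φ : ℂ) : Multiplicative ℤ →* LA where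
  toFun n := LaurentPolynomial.C (Complex.exp ((Multiplicative.toAdd n : ℤ) * (φ * I))) *
    LaurentPolynomial.T (Multiplicative.toAdd n)
  map_one' := by simp
  map_mul' a b := by
    simp only [toAdd_mul, Int.cast_add, add_mul, Complex.exp_add, LaurentPolynomial.T_add, map_mul]
    ring

/-- translation of the angle -/
def rot (φ : ℂ) : LA →ₐ[ℂ] LA := AddMonoidAlgebra.lift ℂ LA ℤ (rotHom φ)

lemma rot_CT (φ a : ℂ) (n : ℤ) :
    rot φ (LaurentPolynomial.C a * LaurentPolynomial.T n) =
      LaurentPolynomial.C (a * Complex.exp (n * (φ * I))) * LaurentPolynomial.T n := by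
  rw [← LaurentPolynomial.single_eq_C_mul_T, rot, AddMonoidAlgebra.lift_single]
  simp [rotHom, LaurentPolynomial.smul_eq_C_mul, mul_assoc]

lemma ev_rot (φ φ₀ : ℂ) (f : LA) : ev φ (rot φ₀ f) = ev (φ + φ₀) f := by
  induction f using LaurentPolynomial.induction_on' with
  | add p q hp hq => simp [hp, hq]
  | C_mul_T n a =>
    rw [rot_CT, ev_CT, ev_CT, mul_assoc, ← Complex.exp_add]
    ring_nf

/-- the derivative in the angle -/
def dph : LA →ₗ[ℂ] LA where
  toFun f := ⟨Finsupp.onFinset f.coeff.support (fun n => I * n * f.coeff n) (by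
    intro n hn; rw [Finsupp.mem_support_iff]; intro h; exact hn (by simp [h]))⟩
  map_add' f g := by
    apply LaurentPolynomial.ext
    intro n; simp [mul_add]
  map_smul' c f := by
    apply LaurentPolynomial.ext
    intro n; simp; ring

lemma dph_coeff (f : LA) (n : ℤ) : (dph f).coeff n = I * n * f.coeff n := rfl

lemma CT_coeff (a : ℂ) (n m : ℤ) :
    (LaurentPolynomial.C a * LaurentPolynomial.T n : LA).coeff m = if n = m then a else 0 := by
  rw [← LaurentPolynomial.single_eq_C_mul_T]
  exact Finsupp.single_apply

lemma dph_CT (a : ℂ) (n : ℤ) :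
    dph (LaurentPolynomial.C a * LaurentPolynomial.T n) =
      LaurentPolynomial.C (I * n * a) * LaurentPolynomial.T n := by
  apply LaurentPolynomial.ext
  intro m
  rw [dph_coeff, CT_coeff, CT_coeff]
  split_ifs with h
  · rw [h]
  · simp

lemma rot_coeff (φ : ℂ) (f : LA) (n : ℤ) :
    (rot φ f).coeff n = Complex.exp (n * (φ * I)) * f.coeff n := by
  induction f using LaurentPolynomial.induction_on' with
  | add p q hp hq => simp [hp, hq, mul_add]
  | C_mul_T m a =>
    rw [rot_CT, CT_coeff, CT_coeff]
    split_ifs with h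
    · rw [h]; ring
    · simp

lemma dph_rot (φ : ℂ) (f : LA) : dph (rot φ f) = rot φ (dph f) := by
  apply LaurentPolynomial.ext
  intro m
  rw [dph_coeff, rot_coeff, rot_coeff, dph_coeff]; ring

lemma hasDerivAt_ev (f : LA) (φ : ℂ) : HasDerivAt (fun x => ev x f) (ev φ (dph f)) φ := by
  induction f using LaurentPolynomial.induction_on' with
  | add p q hp hq =>
    simp only [map_add]
    exact hp.add hq
  | C_mul_T m a =>
    rw [dph_CT]
    simp only [ev_CT]
    have h1 : HasDerivAt (fun x : ℂ => (m : ℂ) * (x * I)) (m * (1 * I)) φ :=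
      ((hasDerivAt_id φ).mul_const I).const_mul _
    have := (h1.cexp).const_mul a
    have e : I * m * a * Complex.exp (m * (φ * I)) = a * (Complex.exp (m * (φ * I)) * (m * (1 * I))) := by
      ring
    rw [e]
    exact this

lemma ev_bound (f : LA) : ∃ B : ℝ, 0 ≤ B ∧ ∀ φ : ℝ, ‖ev (φ : ℂ) f‖ ≤ B := by
  induction f using LaurentPolynomial.induction_on' with
  | add p q hp hq =>
    obtain ⟨B, hB, h⟩ := hp
    obtain ⟨B', hB', h'⟩ := hq
    refine ⟨B + B', by positivity, fun φ => ?_⟩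
    rw [map_add]
    exact (norm_add_le _ _).trans (add_le_add (h φ) (h' φ))
  | C_mul_T m a =>
    refine ⟨‖a‖, norm_nonneg _, fun φ => ?_⟩
    rw [ev_CT, norm_mul]
    have : ((m : ℂ) * ((φ : ℂ) * I)) = ((m * φ : ℝ) : ℂ) * I := by push_cast; ring
    rw [this, Complex.norm_exp_ofReal_mul_I, mul_one]

lemma ev_eq_zero (f : LA) (h : ∀ φ : ℝ, ev (φ : ℂ) f = 0) : f = 0 := by
  obtain ⟨n, p, hp⟩ := LaurentPolynomial.exists_T_pow f
  have key : ∀ (p : Polynomial ℂ) (φ : ℂ), ev φ (Polynomial.toLaurent p) = p.eval (Complex.exp (φ * I)) := by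
    intro p φ
    induction p using Polynomial.induction_on' with
    | add p q hp hq => simp [hp, hq]
    | monomial n a =>
      rw [Polynomial.toLaurent_C_mul_T, ev_CT, Polynomial.eval_monomial, ← Complex.exp_nat_mul]
      simp
  have hp0 : p = 0 := by
    apply Polynomial.eq_zero_of_infinite_isRoot
    have hinf : (Set.range (fun x : ℝ => Complex.exp ((x : ℂ) * I))).Infinite := by
      have hinj : Set.InjOn (fun x : ℝ => Complex.exp ((x : ℂ) * I)) (Set.Ioo (0:ℝ) 1) := by
        intro x hx y hy hxy
        have := Complex.exp_eq_exp_iff_exists_int.mp hxy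
        obtain ⟨k, hk⟩ := this
        have h2 : (x : ℂ) = y + k * (2 * Real.pi) := by
          have : ((x:ℂ) - (y + k * (2 * Real.pi))) * I = 0 := by
            linear_combination hk
          rcases mul_eq_zero.mp this with h | h
          · linear_combination h
          · exact absurd h I_ne_zero
        have h3 : x = y + k * (2 * Real.pi) := by exact_mod_cast h2
        have hpi := Real.pi_gt_three
        have hk0 : k = 0 := by
          by_contra hk0
          rcases lt_or_gt_of_ne hk0 with h | h
          · have : (k : ℝ) ≤ -1 := by exact_mod_cast Int.le_sub_one_of_lt h
            nlinarith [hx.1, hx.2, hy.1, hy.2]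
          · have : (1 : ℝ) ≤ k := by exact_mod_cast h
            nlinarith [hx.1, hx.2, hy.1, hy.2]
        rw [h3, hk0]; simp
      refine ((Set.Ioo_infinite (by norm_num : (0:ℝ) < 1)).image hinj).mono ?_
      rintro _ ⟨x, -, rfl⟩
      exact ⟨x, rfl⟩
    refine hinf.mono ?_
    rintro _ ⟨x, rfl⟩
    show p.IsRoot _
    rw [Polynomial.IsRoot.def]
    rw [← key, hp, map_mul, h x, zero_mul]
  rw [hp0, map_zero] at hp
  have := (LaurentPolynomial.isUnit_T (R := ℂ) (n : ℤ)).mul_left_eq_zero.mp hp.symm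
  exact this

lemma ev_injective_real {f g : LA} (h : ∀ φ : ℝ, ev (φ : ℂ) f = ev (φ : ℂ) g) : f = g := by
  rw [← sub_eq_zero]
  apply ev_eq_zero
  intro φ
  rw [map_sub, h φ, sub_self]

/-- `cos` and `sin` as Laurent polynomials -/
def lcos : LA := LaurentPolynomial.C (1/2) * LaurentPolynomial.T 1 +
  LaurentPolynomial.C (1/2) * LaurentPolynomial.T (-1)
def lsin : LA := LaurentPolynomial.C (-I/2) * LaurentPolynomial.T 1 +
  LaurentPolynomial.C (I/2) * LaurentPolynomial.T (-1)

lemma ev_lcos (φ : ℂ) : ev φ lcos = Complex.cos φ := by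
  rw [lcos, map_add, ev_CT, ev_CT, Complex.cos]
  push_cast
  ring_nf

lemma ev_lsin (φ : ℂ) : ev φ lsin = Complex.sin φ := by
  rw [lsin, map_add, ev_CT, ev_CT, Complex.sin]
  push_cast
  ring_nf

lemma trig_of_isTrigPoly {f : ℂ → ℂ} (hf : IsTrigPoly f) : ∃ g : LA, ∀ φ, f φ = ev φ g := by
  obtain ⟨n, a, b, h⟩ := hf
  refine ⟨LaurentPolynomial.C (a 0) + ∑ k ∈ Finset.Icc 1 n,
    (LaurentPolynomial.C (a k) * (LaurentPolynomial.C (1/2) * LaurentPolynomial.T (k:ℤ) +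
      LaurentPolynomial.C (1/2) * LaurentPolynomial.T (-(k:ℤ))) +
     LaurentPolynomial.C (b k) * (LaurentPolynomial.C (-I/2) * LaurentPolynomial.T (k:ℤ) +
      LaurentPolynomial.C (I/2) * LaurentPolynomial.T (-(k:ℤ)))), fun φ => ?_⟩
  rw [h φ, map_add, ev_C, map_sum]
  congr 1
  refine Finset.sum_congr rfl fun k _ => ?_
  rw [map_add, map_mul, map_mul, map_add, map_add, ev_CT, ev_CT, ev_CT, ev_CT, ev_C, ev_C,
    Complex.cos, Complex.sin]
  push_cast
  ring_nf

lemma isTrigPoly_ev (g : LA) : IsTrigPoly (fun φ => ev φ g) := by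
  induction g using LaurentPolynomial.induction_on' with
  | add p q hp hq =>
    obtain ⟨n, a, b, h⟩ := hp
    obtain ⟨n', a', b', h'⟩ := hq
    have aux : ∀ (n N : ℕ) (a b : ℕ → ℂ) (φ : ℂ), n ≤ N →
        ∑ k ∈ Finset.Icc 1 n, (a k * Complex.cos (k * φ) + b k * Complex.sin (k * φ)) =
        ∑ k ∈ Finset.Icc 1 N, ((if k ≤ n then a k else 0) * Complex.cos (k * φ) +
          (if k ≤ n then b k else 0) * Complex.sin (k * φ)) := by
      intro n N a b φ hN
      rw [← Finset.sum_subset (Finset.Icc_subset_Icc_right hN)]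
      · refine Finset.sum_congr rfl fun k hk => ?_
        rw [if_pos (Finset.mem_Icc.mp hk).2, if_pos (Finset.mem_Icc.mp hk).2]
      · intro k hk hk'
        have : ¬ k ≤ n := fun h => hk' (Finset.mem_Icc.mpr ⟨(Finset.mem_Icc.mp hk).1, h⟩)
        simp [this]
    refine ⟨max n n', fun k => (if k ≤ n then a k else 0) + (if k ≤ n' then a' k else 0),
      fun k => (if k ≤ n then b k else 0) + (if k ≤ n' then b' k else 0), fun φ => ?_⟩
    have e1 := h φ
    have e2 := h' φ
    rw [aux n (max n n') a b φ (le_max_left _ _)] at e1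
    rw [aux n' (max n n') a' b' φ (le_max_right _ _)] at e2
    simp only [map_add]
    simp only at e1 e2
    rw [e1, e2]
    simp only [Nat.zero_le, if_true]
    rw [add_add_add_comm, ← Finset.sum_add_distrib]
    congr 1
    refine Finset.sum_congr rfl fun k hk => ?_
    ring
  | C_mul_T m a =>
    rcases Int.lt_trichotomy m 0 with hm | hm | hm
    · obtain ⟨k, hk⟩ := Int.exists_eq_neg_ofNat hm.le
      subst hk
      have hk : 1 ≤ k := by omega
      refine ⟨k, fun j => if j = k then a else 0, fun j => if j = k then -I * a else 0, fun φ => ?_⟩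
      rw [Finset.sum_eq_single k]
      · have : (0:ℕ) ≠ k := by omega
        simp only [ev_CT, this, if_false, if_true]
        have e : Complex.exp (((-(k:ℤ) : ℤ) : ℂ) * (φ * I)) = Complex.cos (k*φ) - Complex.sin (k * φ) * I := by
          rw [show (((-(k:ℤ) : ℤ) : ℂ) * (φ * I)) = (-(k*φ)) * I by push_cast; ring, Complex.exp_mul_I]
          simp [Complex.cos_neg, Complex.sin_neg]; ring
        rw [e]; ring
      · intro j _ hj; simp [hj]
      · intro h; exact absurd (Finset.mem_Icc.mpr ⟨hk, le_rfl⟩) h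
    · subst hm
      refine ⟨0, fun _ => a, fun _ => 0, fun φ => ?_⟩
      simp [ev_C]
    · obtain ⟨k, hk⟩ := Int.eq_ofNat_of_zero_le hm.le
      subst hk
      have hk : 1 ≤ k := by omega
      refine ⟨k, fun j => if j = k then a else 0, fun j => if j = k then I * a else 0, fun φ => ?_⟩
      rw [Finset.sum_eq_single k]
      · have : (0:ℕ) ≠ k := by omega
        simp only [ev_CT, this, if_false, if_true]
        have e : Complex.exp (((k:ℤ) : ℂ) * (φ * I)) = Complex.cos (k*φ) + Complex.sin (k * φ) * I := by
          rw [show (((k:ℤ) : ℂ) * (φ * I)) = (k*φ) * I by push_cast; ring, Complex.exp_mul_I]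
        rw [e]; ring
      · intro j _ hj; simp [hj]
      · intro h; exact absurd (Finset.mem_Icc.mpr ⟨hk, le_rfl⟩) h

/-- solvability of the first order linear equation in the angle -/
lemma exists_dph_sub (k : ℤ) (g : LA) (hg : g.coeff k = 0) :
    ∃ u : LA, dph u - LaurentPolynomial.C (I * k) * u = g := by
  refine ⟨⟨Finsupp.onFinset g.coeff.support (fun n => g.coeff n / (I * (n - k))) (by
    intro n hn; rw [Finsupp.mem_support_iff]; intro h; exact hn (by simp [h]))⟩, ?_⟩
  apply LaurentPolynomial.ext
  intro n
  rw [← LaurentPolynomial.smul_eq_C_mul, AddMonoidAlgebra.coeff_sub, AddMonoidAlgebra.coeff_smul]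
  show (dph _).coeff n - (I * k) * (g.coeff n / (I * (n - k))) = g.coeff n
  rw [dph_coeff]
  show I * n * (g.coeff n / (I * (n - k))) - (I * k) * (g.coeff n / (I * (n - k))) = g.coeff n
  by_cases h : n = k
  · subst h; simp [hg]
  · have : (n : ℂ) - k ≠ 0 := by
      rw [sub_ne_zero]; exact_mod_cast h
    field_simp

lemma dph_sub_coeff (k : ℤ) (u : LA) : (dph u - LaurentPolynomial.C (I * k) * u).coeff k = 0 := by
  rw [← LaurentPolynomial.smul_eq_C_mul, AddMonoidAlgebra.coeff_sub, AddMonoidAlgebra.coeff_smul]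
  show (dph u).coeff k - (I * k) * u.coeff k = 0
  rw [dph_coeff]; ring

lemma dph_ker (k : ℤ) (u : LA) (h : dph u - LaurentPolynomial.C (I * k) * u = 0) :
    u = LaurentPolynomial.C (u.coeff k) * LaurentPolynomial.T k := by
  apply LaurentPolynomial.ext
  intro n
  rw [CT_coeff]
  split_ifs with hn
  · rw [hn]
  · have h1 : (dph u - LaurentPolynomial.C (I * k) * u).coeff n = 0 := by rw [h]; rfl
    rw [← LaurentPolynomial.smul_eq_C_mul, AddMonoidAlgebra.coeff_sub, AddMonoidAlgebra.coeff_smul] at h1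
    have h2 : (dph u).coeff n - (I * k) * u.coeff n = 0 := h1
    rw [dph_coeff] at h2
    have h3 : (I * ((n:ℂ) - k)) * u.coeff n = 0 := by linear_combination h2
    have : (n : ℂ) - k ≠ 0 := by
      rw [sub_ne_zero]; exact_mod_cast (Ne.symm hn)
    rcases mul_eq_zero.mp h3 with h4 | h4
    · exact absurd h4 (mul_ne_zero I_ne_zero this)
    · exact h4


/-! ## Weighted orders of polynomials and formal series -/

abbrev RR := PowerSeries LA
abbrev MP := MvPolynomial (Fin 4) ℂ
/-- the formal variable `s = τ⁻¹` -/
abbrev sX : RR := PowerSeries.X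

def wt (i : Fin 4) : ℕ := if (i : ℕ) < 2 then 2 else 1

lemma psOrd_succ (N : ℕ) (i : Fin 4) : psOrd N i + 1 = N + wt i := by
  unfold psOrd wt; split_ifs <;> omega

def mw (m : Fin 4 →₀ ℕ) : ℕ := ∑ i, m i * wt i

/-- all monomials of `p` have weight at least `w` -/
def WOrd (w : ℕ) (p : MP) : Prop := ∀ m, p.coeff m ≠ 0 → w ≤ mw m

lemma WOrd.mono {w w' : ℕ} {p : MP} (h : WOrd w p) (hw : w' ≤ w) : WOrd w' p :=
  fun m hm => hw.trans (h m hm)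

lemma WOrd.add {w : ℕ} {p q : MP} (hp : WOrd w p) (hq : WOrd w q) : WOrd w (p + q) := by
  intro m hm
  by_cases h : p.coeff m = 0
  · apply hq; intro h'; apply hm; simp [h, h']
  · exact hp m h

lemma WOrd.neg {w : ℕ} {p : MP} (hp : WOrd w p) : WOrd w (-p) := by
  intro m hm
  apply hp; intro h; apply hm; simp [h]

lemma WOrd.zero (w : ℕ) : WOrd w (0 : MP) := by
  intro m hm; simp at hm

lemma WOrd.sum {ι : Type*} (s : Finset ι) (f : ι → MP) {w : ℕ} (h : ∀ i ∈ s, WOrd w (f i)) :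
    WOrd w (∑ i ∈ s, f i) := by
  classical
  induction s using Finset.induction_on with
  | empty => simpa using WOrd.zero w
  | insert a s ha ih =>
    rw [Finset.sum_insert ha]
    exact (h a (by simp)).add (ih fun i hi => h i (by simp [hi]))

lemma mw_add (m n : Fin 4 →₀ ℕ) : mw (m + n) = mw m + mw n := by
  simp [mw, add_mul, Finset.sum_add_distrib]

lemma mw_single (i : Fin 4) (n : ℕ) : mw (Finsupp.single i n) = n * wt i := by
  unfold mw
  rw [Finset.sum_eq_single i]
  · simp
  · intro j _ hj; simp [Ne.symm hj]
  · simp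

lemma WOrd.pderiv {w : ℕ} {p : MP} (hp : WOrd w p) (j : Fin 4) :
    WOrd (w - wt j) (MvPolynomial.pderiv j p) := by
  classical
  intro m hm
  have h : p.coeff (m + Finsupp.single j 1) ≠ 0 := by
    intro h
    apply hm
    rw [MvPolynomial.coeff_pderiv, h]
    simp
  have := hp _ h
  rw [mw_add, mw_single] at this
  omega

lemma WOrd.mul {w w' : ℕ} {p q : MP} (hp : WOrd w p) (hq : WOrd w' q) : WOrd (w + w') (p * q) := by
  classical
  intro m hm
  rw [MvPolynomial.coeff_mul] at hm
  obtain ⟨⟨a, b⟩, hab, h⟩ := Finset.exists_ne_zero_of_sum_ne_zero hm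
  rw [Finset.HasAntidiagonal.mem_antidiagonal] at hab
  simp only at hab h
  rw [← hab, mw_add]
  exact add_le_add (hp a (left_ne_zero_of_mul h)) (hq b (right_ne_zero_of_mul h))

lemma WOrd.C (a : ℂ) : WOrd 0 (MvPolynomial.C a : MP) := fun _ _ => Nat.zero_le _

lemma WOrd.X (i : Fin 4) : WOrd (wt i) (MvPolynomial.X i : MP) := by
  classical
  intro m hm
  rw [MvPolynomial.coeff_X] at hm
  split_ifs at hm with h
  · rw [← h, mw_single]; simp
  · exact absurd rfl hm

/-- `x i = O (s ^ (k + wt i))` -/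
def SS (k : ℕ) (x : Fin 4 → RR) : Prop := ∀ i, sX ^ (k + wt i) ∣ x i

lemma SS.mono {k k' : ℕ} {x : Fin 4 → RR} (h : SS k x) (hk : k' ≤ k) : SS k' x :=
  fun i => (pow_dvd_pow _ (by omega)).trans (h i)

lemma SS.add {k : ℕ} {x y : Fin 4 → RR} (hx : SS k x) (hy : SS k y) : SS k (x + y) :=
  fun i => dvd_add (hx i) (hy i)

lemma SS.sub {k : ℕ} {x y : Fin 4 → RR} (hx : SS k x) (hy : SS k y) : SS k (x - y) :=
  fun i => dvd_sub (hx i) (hy i)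

lemma prod_pow_weight (u : Fin 4 → RR) (m : Fin 4 →₀ ℕ) :
    ∏ i, (sX ^ (wt i) * u i) ^ m i = sX ^ mw m * ∏ i, u i ^ m i := by
  simp only [mul_pow, Finset.prod_mul_distrib, ← pow_mul, Finset.prod_pow_eq_pow_sum, mw]
  congr 2
  exact Finset.sum_congr rfl fun i _ => mul_comm _ _

lemma prod_sub_dvd (u v : Fin 4 → RR) (r : RR) (h : ∀ i, r ∣ u i - v i) (m : Fin 4 →₀ ℕ) :
    r ∣ ∏ i, u i ^ m i - ∏ i, v i ^ m i := by
  have h' : ∀ i, Ideal.Quotient.mk (Ideal.span {r}) (u i) = Ideal.Quotient.mk (Ideal.span {r}) (v i) := by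
    intro i
    rw [Ideal.Quotient.eq, Ideal.mem_span_singleton]
    exact h i
  rw [← Ideal.mem_span_singleton, ← Ideal.Quotient.eq, map_prod, map_prod]
  simp only [map_pow, h']

lemma aeval_sub_dvd {w k : ℕ} {p : MP} (hp : WOrd w p) {x y : Fin 4 → RR} (hy : SS 0 y)
    (hxy : SS k (x - y)) :
    sX ^ (w + k) ∣ MvPolynomial.aeval x p - MvPolynomial.aeval y p := by
  choose v hv using hy
  choose c hc using hxy
  simp only [zero_add] at hv
  have hx : ∀ i, x i = sX ^ (wt i) * (v i + sX ^ k * c i) := by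
    intro i
    have := hc i
    rw [Pi.sub_apply, hv i] at this
    linear_combination this
  rw [MvPolynomial.aeval_def, MvPolynomial.aeval_def, MvPolynomial.eval₂_eq', MvPolynomial.eval₂_eq',
    ← Finset.sum_sub_distrib]
  refine Finset.dvd_sum fun m hm => ?_
  rw [← mul_sub]
  apply Dvd.dvd.mul_left
  simp only [hx, hv]
  rw [prod_pow_weight, prod_pow_weight, ← mul_sub, pow_add]
  apply mul_dvd_mul
  · exact pow_dvd_pow _ (hp m (MvPolynomial.mem_support_iff.mp hm))
  · apply prod_sub_dvd
    intro i
    simp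

lemma aeval_dvd {w : ℕ} {p : MP} (hp : WOrd w p) {x : Fin 4 → RR} (hx : SS 0 x) :
    sX ^ w ∣ MvPolynomial.aeval x p := by
  choose v hv using hx
  simp only [zero_add] at hv
  rw [MvPolynomial.aeval_def, MvPolynomial.eval₂_eq']
  refine Finset.dvd_sum fun m hm => ?_
  apply Dvd.dvd.mul_left
  simp only [hv]
  rw [prod_pow_weight]
  exact Dvd.dvd.mul_right (pow_dvd_pow _ (hp m (MvPolynomial.mem_support_iff.mp hm))) _

/-! ## The operator `D` on formal series -/

def DD : RR →ₗ[ℂ] RR where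
  toFun f := PowerSeries.mk fun k => dph (PowerSeries.coeff k f) -
    ((k : ℂ) - 1) • (if k = 0 then 0 else PowerSeries.coeff (k - 1) f)
  map_add' f g := by
    ext1 k
    simp only [PowerSeries.coeff_mk, map_add]
    split_ifs <;> simp only [smul_zero, smul_add] <;> abel
  map_smul' c f := by
    ext1 k
    simp only [PowerSeries.coeff_mk, RingHom.id_apply, PowerSeries.coeff_smul, LinearMap.map_smul]
    split_ifs
    · simp
    · rw [smul_sub, smul_comm]

lemma DD_coeff_zero (f : RR) : PowerSeries.coeff 0 (DD f) = dph (PowerSeries.coeff 0 f) := by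
  simp [DD]

lemma DD_coeff_succ (f : RR) (k : ℕ) : PowerSeries.coeff (k + 1) (DD f) =
    dph (PowerSeries.coeff (k + 1) f) - (k : ℂ) • PowerSeries.coeff k f := by
  simp [DD]

lemma DD_dvd {n : ℕ} {f : RR} (h : sX ^ n ∣ f) : sX ^ n ∣ DD f := by
  rw [PowerSeries.X_pow_dvd_iff] at h ⊢
  intro m hm
  cases m with
  | zero => rw [DD_coeff_zero, h 0 hm, map_zero]
  | succ m => rw [DD_coeff_succ, h _ hm, h m (by omega), map_zero, smul_zero, sub_zero]

/-- scalars as formal series -/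
abbrev cc : ℂ →+* RR := algebraMap ℂ RR

lemma cc_mul (a : ℂ) (f : RR) : cc a * f = a • f := (Algebra.smul_def a f).symm

lemma DD_cc_mul (a : ℂ) (f : RR) : DD (cc a * f) = cc a * DD f := by
  rw [cc_mul, cc_mul, LinearMap.map_smul]

lemma cc_eq (a : ℂ) : cc a = PowerSeries.C (LaurentPolynomial.C a) := by
  rw [PowerSeries.algebraMap_apply]; rfl


/-! ## The formal residual -/

/-- The polynomial Hamiltonian vector field. -/
def Yv (η : ℂ) (P : MP) : Fin 4 → MP :=
  ![-MvPolynomial.X 1 + MvPolynomial.C η * (MvPolynomial.X 2 ^ 2 + MvPolynomial.X 3 ^ 2) * MvPolynomial.X 2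
      + MvPolynomial.pderiv 2 P,
    MvPolynomial.X 0 + MvPolynomial.C η * (MvPolynomial.X 2 ^ 2 + MvPolynomial.X 3 ^ 2) * MvPolynomial.X 3
      + MvPolynomial.pderiv 3 P,
    -MvPolynomial.X 3 + -MvPolynomial.X 0 + -MvPolynomial.pderiv 0 P,
    MvPolynomial.X 2 + -MvPolynomial.X 1 + -MvPolynomial.pderiv 1 P]

def Res (η : ℂ) (P : MP) (x : Fin 4 → RR) (i : Fin 4) : RR :=
  DD (x i) - MvPolynomial.aeval x (Yv η P i)

lemma WOrd_Yv (η : ℂ) {P : MP} (hP : WOrd 5 P) (i : Fin 4) : WOrd (wt i) (Yv η P i) := by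
  have hs : WOrd 2 (MvPolynomial.X 2 ^ 2 + MvPolynomial.X 3 ^ 2 : MP) := by
    rw [pow_two, pow_two]
    exact ((WOrd.X 2).mul (WOrd.X 2)).add ((WOrd.X 3).mul (WOrd.X 3))
  have hs' : WOrd 2 (MvPolynomial.C η * (MvPolynomial.X 2 ^ 2 + MvPolynomial.X 3 ^ 2) : MP) := by
    have := (WOrd.C η).mul hs
    simpa using this
  fin_cases i
  · show WOrd 2 (_ + _ + _ : MP)
    refine ((WOrd.X 1).neg.add ((hs'.mul (WOrd.X 2)).mono ?_)).add ((hP.pderiv 2).mono ?_) <;> decide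
  · show WOrd 2 (_ + _ + _ : MP)
    refine ((WOrd.X 0).add ((hs'.mul (WOrd.X 3)).mono ?_)).add ((hP.pderiv 3).mono ?_) <;> decide
  · show WOrd 1 (_ + _ + _ : MP)
    refine ((WOrd.X 3).neg.add ((WOrd.X 0).neg.mono ?_)).add ((hP.pderiv 0).neg.mono ?_) <;> decide
  · show WOrd 1 (_ + _ + _ : MP)
    refine ((WOrd.X 2).add ((WOrd.X 1).neg.mono ?_)).add ((hP.pderiv 1).neg.mono ?_) <;> decide

/-- the residual is a contraction-compatible map -/
lemma Res_sub_dvd (η : ℂ) {P : MP} (hP : WOrd 5 P) {x y : Fin 4 → RR} {k : ℕ} (hy : SS 0 y)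
    (hxy : SS k (x - y)) (i : Fin 4) : sX ^ (k + wt i) ∣ Res η P x i - Res η P y i := by
  have h1 : Res η P x i - Res η P y i =
    DD ((x - y) i) - (MvPolynomial.aeval x (Yv η P i) - MvPolynomial.aeval y (Yv η P i)) := by
    simp only [Res, Pi.sub_apply, map_sub]; ring
  rw [h1]
  refine dvd_sub (DD_dvd (hxy i)) ?_
  have := aeval_sub_dvd (WOrd_Yv η hP i) hy hxy
  rwa [add_comm] at this

lemma Yv_add (η : ℂ) (P Q : MP) (M : ℕ) (hQ : WOrd M Q) (i : Fin 4) :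
    ∃ q : MP, WOrd (M - 2) q ∧ Yv η (P + Q) i = Yv η P i + q := by
  have h : ∀ j, WOrd (M - 2) (MvPolynomial.pderiv j Q) := fun j =>
    (hQ.pderiv j).mono (by unfold wt; split_ifs <;> omega)
  fin_cases i
  · exact ⟨_, h 2, by simp [Yv]; ring⟩
  · exact ⟨_, h 3, by simp [Yv]; ring⟩
  · exact ⟨_, (h 0).neg, by simp [Yv]; ring⟩
  · exact ⟨_, (h 1).neg, by simp [Yv]; ring⟩

lemma Res_trunc_dvd (η : ℂ) {P Q : MP} {M : ℕ} (hQ : WOrd M Q) {x : Fin 4 → RR} (hx : SS 0 x)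
    (i : Fin 4) : sX ^ (M - 2) ∣ Res η (P + Q) x i - Res η P x i := by
  obtain ⟨q, hq, e⟩ := Yv_add η P Q M hQ i
  have : Res η (P + Q) x i - Res η P x i = - MvPolynomial.aeval x q := by
    simp only [Res, e, map_add]; ring
  rw [this, dvd_neg]
  exact aeval_dvd hq hx

/-! ### complex coordinates -/

def zc (e : ℤ) (x : Fin 4 → RR) : RR := x 0 + cc (I * e) * x 1
def wc (e : ℤ) (x : Fin 4 → RR) : RR := x 2 + cc (I * e) * x 3

def resz (η : ℂ) (P : MP) (e : ℤ) (x : Fin 4 → RR) : RR := Res η P x 0 + cc (I * e) * Res η P x 1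
def resw (η : ℂ) (P : MP) (e : ℤ) (x : Fin 4 → RR) : RR := Res η P x 2 + cc (I * e) * Res η P x 3

def phz (P : MP) (e : ℤ) (x : Fin 4 → RR) : RR :=
  MvPolynomial.aeval x (MvPolynomial.pderiv 2 P) + cc (I * e) * MvPolynomial.aeval x (MvPolynomial.pderiv 3 P)
def phw (P : MP) (e : ℤ) (x : Fin 4 → RR) : RR :=
  MvPolynomial.aeval x (MvPolynomial.pderiv 0 P) + cc (I * e) * MvPolynomial.aeval x (MvPolynomial.pderiv 1 P)

lemma cc_I_sq (e : ℤ) (he : e * e = 1) : cc (I * e) * cc (I * e) = -1 := by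
  rw [← map_mul]
  have : (I * e * (I * e) : ℂ) = -1 := by
    have h : (e : ℂ) * e = 1 := by exact_mod_cast he
    linear_combination (I * I) * h + I_mul_I
  rw [this, map_neg, map_one]

lemma cc_neg_e (e : ℤ) : cc (I * ((-e : ℤ) : ℂ)) = - cc (I * e) := by
  rw [← map_neg]; congr 1; push_cast; ring

lemma resz_eq (η : ℂ) (P : MP) (e : ℤ) (he : e * e = 1) (x : Fin 4 → RR) :
    resz η P e x = DD (zc e x) - cc (I * e) * zc e x - cc η * (wc e x ^ 2 * wc (-e) x) - phz P e x := by
  have h0 : MvPolynomial.aeval x (Yv η P 0) = - x 1 + cc η * (x 2 ^ 2 + x 3 ^ 2) * x 2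
      + MvPolynomial.aeval x (MvPolynomial.pderiv 2 P) := by
    simp [Yv]
  have h1 : MvPolynomial.aeval x (Yv η P 1) = x 0 + cc η * (x 2 ^ 2 + x 3 ^ 2) * x 3
      + MvPolynomial.aeval x (MvPolynomial.pderiv 3 P) := by
    simp [Yv]
  have hc := cc_I_sq e he
  simp only [resz, Res, h0, h1, zc, wc, phz, cc_neg_e, map_add, DD_cc_mul]
  generalize cc (I * e) = c at hc ⊢
  linear_combination (x 1 - cc η * (x 2 + c * x 3) * x 3 ^ 2) * hc

lemma resw_eq (η : ℂ) (P : MP) (e : ℤ) (he : e * e = 1) (x : Fin 4 → RR) :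
    resw η P e x = DD (wc e x) - cc (I * e) * wc e x + zc e x + phw P e x := by
  have h0 : MvPolynomial.aeval x (Yv η P 2) = - x 3 - x 0
      - MvPolynomial.aeval x (MvPolynomial.pderiv 0 P) := by
    simp [Yv]; ring
  have h1 : MvPolynomial.aeval x (Yv η P 3) = x 2 - x 1
      - MvPolynomial.aeval x (MvPolynomial.pderiv 1 P) := by
    simp [Yv]; ring
  have hc := cc_I_sq e he
  simp only [resw, Res, h0, h1, zc, wc, phw, map_add, DD_cc_mul]
  generalize cc (I * e) = c at hc ⊢
  linear_combination (x 3) * hc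

lemma phz_sub_dvd {P : MP} (hP : WOrd 5 P) (e : ℤ) {x y : Fin 4 → RR} {k : ℕ} (hy : SS 0 y)
    (hxy : SS k (x - y)) : sX ^ (k + 4) ∣ phz P e x - phz P e y := by
  have h2 := aeval_sub_dvd (hP.pderiv 2) hy hxy
  have h3 := aeval_sub_dvd (hP.pderiv 3) hy hxy
  have e1 : 5 - wt 2 + k = k + 4 := by simp [wt]; omega
  have e2 : 5 - wt 3 + k = k + 4 := by simp [wt]; omega
  rw [e1] at h2
  rw [e2] at h3
  have : phz P e x - phz P e y = (MvPolynomial.aeval x (MvPolynomial.pderiv 2 P) -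
    MvPolynomial.aeval y (MvPolynomial.pderiv 2 P)) + cc (I * e) * (MvPolynomial.aeval x (MvPolynomial.pderiv 3 P) -
    MvPolynomial.aeval y (MvPolynomial.pderiv 3 P)) := by
    simp only [phz]; ring
  rw [this]
  exact dvd_add h2 (h3.mul_left _)

lemma phw_sub_dvd {P : MP} (hP : WOrd 5 P) (e : ℤ) {x y : Fin 4 → RR} {k : ℕ} (hy : SS 0 y)
    (hxy : SS k (x - y)) : sX ^ (k + 3) ∣ phw P e x - phw P e y := by
  have h2 := aeval_sub_dvd (hP.pderiv 0) hy hxy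
  have h3 := aeval_sub_dvd (hP.pderiv 1) hy hxy
  have e1 : 5 - wt 0 + k = k + 3 := by simp [wt]; omega
  have e2 : 5 - wt 1 + k = k + 3 := by simp [wt]; omega
  rw [e1] at h2
  rw [e2] at h3
  have : phw P e x - phw P e y = (MvPolynomial.aeval x (MvPolynomial.pderiv 0 P) -
    MvPolynomial.aeval y (MvPolynomial.pderiv 0 P)) + cc (I * e) * (MvPolynomial.aeval x (MvPolynomial.pderiv 1 P) -
    MvPolynomial.aeval y (MvPolynomial.pderiv 1 P)) := by
    simp only [phw]; ring
  rw [this]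
  exact dvd_add h2 (h3.mul_left _)

lemma zc_dvd {k : ℕ} {x : Fin 4 → RR} (hx : SS k x) (e : ℤ) : sX ^ (k + 2) ∣ zc e x :=
  dvd_add (hx 0) ((hx 1).mul_left _)

lemma wc_dvd {k : ℕ} {x : Fin 4 → RR} (hx : SS k x) (e : ℤ) : sX ^ (k + 1) ∣ wc e x :=
  dvd_add (hx 2) ((hx 3).mul_left _)

lemma zc_add (e : ℤ) (x y : Fin 4 → RR) : zc e (x + y) = zc e x + zc e y := by
  simp [zc]; ring
lemma wc_add (e : ℤ) (x y : Fin 4 → RR) : wc e (x + y) = wc e x + wc e y := by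
  simp [wc]; ring

/-- leading coefficients of `x` -/
def Lead (α : ℤ → ℂ) (x : Fin 4 → RR) : Prop :=
  ∀ e : ℤ, e * e = 1 → PowerSeries.coeff 1 (wc e x) = LaurentPolynomial.C (α e) * LaurentPolynomial.T e

lemma wc_lead {α : ℤ → ℂ} {x : Fin 4 → RR} (hx : SS 0 x) (hl : Lead α x) (e : ℤ) (he : e * e = 1) :
    ∃ r : RR, wc e x = sX * PowerSeries.C (LaurentPolynomial.C (α e) * LaurentPolynomial.T e) + sX ^ 2 * r := by
  have : sX ^ 2 ∣ wc e x - sX * PowerSeries.C (LaurentPolynomial.C (α e) * LaurentPolynomial.T e) := by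
    rw [PowerSeries.X_pow_dvd_iff]
    intro m hm
    have h0 : PowerSeries.coeff 0 (wc e x) = 0 := by
      have := wc_dvd hx e
      rw [PowerSeries.X_pow_dvd_iff] at this
      exact this 0 (by omega)
    interval_cases m
    · rw [map_sub, h0]; simp
    · rw [map_sub, hl e he, PowerSeries.coeff_succ_X_mul]; simp
  obtain ⟨r, hr⟩ := this
  exact ⟨r, by linear_combination hr⟩

lemma resw_lin (η : ℂ) {P : MP} (hP : WOrd 5 P) (e : ℤ) (he : e * e = 1) {x y : Fin 4 → RR} {k : ℕ}
    (hx : SS 0 x) (hy : SS k y) :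
    sX ^ (k + 3) ∣ resw η P e (x + y) - resw η P e x - (DD (wc e y) - cc (I * e) * wc e y + zc e y) := by
  have h := phw_sub_dvd hP e hx (x := x + y) (k := k) (by simpa using hy)
  have : resw η P e (x + y) - resw η P e x - (DD (wc e y) - cc (I * e) * wc e y + zc e y) =
    phw P e (x + y) - phw P e x := by
    rw [resw_eq η P e he, resw_eq η P e he, wc_add, zc_add, map_add]; ring
  rw [this]; exact h

lemma resz_lin (η : ℂ) {P : MP} (hP : WOrd 5 P) (e : ℤ) (he : e * e = 1) {x y : Fin 4 → RR} {k : ℕ}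
    (hk : 1 ≤ k) (hx : SS 0 x) (hy : SS k y) {α : ℤ → ℂ} (hl : Lead α x) :
    sX ^ (k + 4) ∣ resz η P e (x + y) - resz η P e x - (DD (zc e y) - cc (I * e) * zc e y
      - cc η * (sX ^ 2 * (cc (2 * α e * α (-e)) * wc e y +
        PowerSeries.C (LaurentPolynomial.C (α e ^ 2) * LaurentPolynomial.T (2 * e)) * wc (-e) y))) := by
  have h := phz_sub_dvd hP e hx (x := x + y) (k := k) (by simpa using hy)
  obtain ⟨r, hr⟩ := wc_lead hx hl e he
  obtain ⟨r', hr'⟩ := wc_lead hx hl (-e) (by simpa using he)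
  obtain ⟨v, hv⟩ := wc_dvd hy e
  obtain ⟨v', hv'⟩ := wc_dvd hy (-e)
  set A : RR := PowerSeries.C (LaurentPolynomial.C (α e) * LaurentPolynomial.T e) with hA
  set B : RR := PowerSeries.C (LaurentPolynomial.C (α (-e)) * LaurentPolynomial.T (-e)) with hB
  have hAB : A * B = cc (α e * α (-e)) := by
    rw [hA, hB, ← map_mul]
    have : (LaurentPolynomial.C (α e) * LaurentPolynomial.T e * (LaurentPolynomial.C (α (-e)) * LaurentPolynomial.T (-e)) : LA)
      = LaurentPolynomial.C (α e * α (-e)) := by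
      rw [mul_mul_mul_comm, ← LaurentPolynomial.T_add, ← map_mul]; simp
    rw [this, cc_eq]
  have hAA : PowerSeries.C (LaurentPolynomial.C (α e ^ 2) * LaurentPolynomial.T (2 * e)) = A ^ 2 := by
    rw [hA, ← map_pow]
    congr 1
    rw [mul_pow, LaurentPolynomial.T_pow, ← map_pow]; simp
  have h2 : cc (2 * α e * α (-e)) = 2 * (A * B) := by
    rw [hAB, mul_assoc, map_mul cc 2, map_ofNat]
  obtain ⟨j, rfl⟩ : ∃ j, k = j + 1 := ⟨k - 1, by omega⟩
  have : resz η P e (x + y) - resz η P e x - (DD (zc e y) - cc (I * e) * zc e y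
      - cc η * (sX ^ 2 * (cc (2 * α e * α (-e)) * wc e y +
        PowerSeries.C (LaurentPolynomial.C (α e ^ 2) * LaurentPolynomial.T (2 * e)) * wc (-e) y))) =
     - (phz P e (x + y) - phz P e x) - sX ^ (j + 1 + 4) * (cc η * (
        2 * (A * r' + B * r + sX * r * r') * v + (2 * A * r + sX * r ^ 2) * v' +
        sX ^ j * (v ^ 2 * (B + sX * r') + 2 * (A + sX * r) * v * v' + sX ^ (j + 1) * v ^ 2 * v'))) := by
    rw [resz_eq η P e he, resz_eq η P e he, wc_add, wc_add, zc_add, map_add, hAA, h2, hr, hr', hv, hv']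
    ring
  rw [this]
  exact dvd_sub (dvd_neg.mpr h) (Dvd.intro _ rfl)


/-! ## One step of the recursion -/

/-- the operator `u ↦ u' - I e u` -/
def Lop (e : ℤ) (u : LA) : LA := dph u - LaurentPolynomial.C (I * e) * u

lemma coeff_cc_mul (a : ℂ) (f : RR) (n : ℕ) :
    PowerSeries.coeff n (cc a * f) = LaurentPolynomial.C a * PowerSeries.coeff n f := by
  rw [cc_eq, PowerSeries.coeff_C_mul]

lemma coeff_zero_of_dvd {n m : ℕ} {f : RR} (h : sX ^ n ∣ f) (hm : m < n) : PowerSeries.coeff m f = 0 :=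
  PowerSeries.X_pow_dvd_iff.mp h m hm

lemma coeff_eq_of_dvd {n m : ℕ} {f g : RR} (h : sX ^ n ∣ f - g) (hm : m < n) :
    PowerSeries.coeff m f = PowerSeries.coeff m g := by
  have := coeff_zero_of_dvd h hm
  rwa [map_sub, sub_eq_zero] at this

lemma recover (x : Fin 4 → RR) :
    x 0 = cc (1/2) * (zc 1 x + zc (-1) x) ∧ x 1 = cc (-I/2) * (zc 1 x - zc (-1) x) ∧
    x 2 = cc (1/2) * (wc 1 x + wc (-1) x) ∧ x 3 = cc (-I/2) * (wc 1 x - wc (-1) x) := by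
  have h1 : cc (1/2) * 2 = 1 := by
    rw [← map_ofNat cc 2, ← map_mul]; norm_num
  have h2 : cc (-I/2) * (2 * cc I) = 1 := by
    rw [← map_ofNat cc 2, ← map_mul, ← map_mul]
    have : (-I / 2 * (2 * I) : ℂ) = 1 := by linear_combination -I_mul_I
    rw [this, map_one]
  have e1 : cc (I * ((1:ℤ):ℂ)) = cc I := by simp
  have e2 : cc (I * ((-1:ℤ):ℂ)) = - cc I := by rw [← map_neg]; congr 1; push_cast; ring
  refine ⟨?_, ?_, ?_, ?_⟩ <;> simp only [zc, wc, e1, e2]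
  · linear_combination -(x 0) * h1
  · linear_combination -(x 1) * h2
  · linear_combination -(x 2) * h1
  · linear_combination -(x 3) * h2

lemma SS_of_zw {k : ℕ} {x : Fin 4 → RR}
    (hz : ∀ e : ℤ, e * e = 1 → sX ^ (k + 2) ∣ zc e x)
    (hw : ∀ e : ℤ, e * e = 1 → sX ^ (k + 1) ∣ wc e x) : SS k x := by
  obtain ⟨h0, h1, h2, h3⟩ := recover x
  have p : (1:ℤ) * 1 = 1 := by norm_num
  have m : (-1:ℤ) * (-1) = 1 := by norm_num
  intro i
  fin_cases i
  · show sX ^ (k + 2) ∣ x 0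
    rw [h0]; exact (dvd_add (hz 1 p) (hz (-1) m)).mul_left _
  · show sX ^ (k + 2) ∣ x 1
    rw [h1]; exact (dvd_sub (hz 1 p) (hz (-1) m)).mul_left _
  · show sX ^ (k + 1) ∣ x 2
    rw [h2]; exact (dvd_add (hw 1 p) (hw (-1) m)).mul_left _
  · show sX ^ (k + 1) ∣ x 3
    rw [h3]; exact (dvd_sub (hw 1 p) (hw (-1) m)).mul_left _

lemma sq_one_cases {e : ℤ} (he : e * e = 1) : e = 1 ∨ e = -1 := by
  exact mul_self_eq_one_iff.mp he

lemma exists_of_zw (Z W : ℤ → RR) : ∃ x : Fin 4 → RR, ∀ e : ℤ, e * e = 1 →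
    zc e x = Z e ∧ wc e x = W e := by
  have h1 : cc (1/2) * 2 = 1 := by
    rw [← map_ofNat cc 2, ← map_mul]; norm_num
  have h2 : cc I * cc (-I/2) = cc (1/2) := by
    rw [← map_mul]
    congr 1
    linear_combination (-1/2) * I_mul_I
  have e1 : cc (I * ((1:ℤ):ℂ)) = cc I := by simp
  have e2 : cc (I * ((-1:ℤ):ℂ)) = - cc I := by rw [← map_neg]; congr 1; push_cast; ring
  refine ⟨![cc (1/2) * (Z 1 + Z (-1)), cc (-I/2) * (Z 1 - Z (-1)), cc (1/2) * (W 1 + W (-1)),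
    cc (-I/2) * (W 1 - W (-1))], fun e he => ?_⟩
  rcases sq_one_cases he with rfl | rfl
  · simp only [zc, wc, e1]
    constructor
    · show cc (1/2) * (Z 1 + Z (-1)) + cc I * (cc (-I/2) * (Z 1 - Z (-1))) = _
      linear_combination (Z 1) * h1 + (Z 1 - Z (-1)) * h2
    · show cc (1/2) * (W 1 + W (-1)) + cc I * (cc (-I/2) * (W 1 - W (-1))) = _
      linear_combination (W 1) * h1 + (W 1 - W (-1)) * h2
  · simp only [zc, wc, e2]
    constructor
    · show cc (1/2) * (Z 1 + Z (-1)) + -cc I * (cc (-I/2) * (Z 1 - Z (-1))) = _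
      linear_combination (Z (-1)) * h1 - (Z 1 - Z (-1)) * h2
    · show cc (1/2) * (W 1 + W (-1)) + -cc I * (cc (-I/2) * (W 1 - W (-1))) = _
      linear_combination (W (-1)) * h1 - (W 1 - W (-1)) * h2

section coeffs
variable (η : ℂ) {P : MP} (hP : WOrd 5 P) (e : ℤ) (he : e * e = 1) {x y : Fin 4 → RR} {k : ℕ}
    (hx : SS 0 x) (hy : SS k y)

lemma resw_coeff1 (hP : WOrd 5 P) (he : e * e = 1) (hx : SS 0 x) (hy : SS k y) :
    PowerSeries.coeff (k + 1) (resw η P e (x + y)) = PowerSeries.coeff (k + 1) (resw η P e x) +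
    Lop e (PowerSeries.coeff (k + 1) (wc e y)) := by
  have h := coeff_zero_of_dvd (resw_lin η hP e he hx hy) (m := k + 1) (by omega)
  have hv := coeff_zero_of_dvd (wc_dvd hy e) (m := k) (by omega)
  have hu := coeff_zero_of_dvd (zc_dvd hy e) (m := k + 1) (by omega)
  simp only [map_sub, map_add, DD_coeff_succ, coeff_cc_mul, hv, hu, smul_zero] at h
  rw [Lop]
  linear_combination h

lemma resw_coeff2 (hP : WOrd 5 P) (he : e * e = 1) (hx : SS 0 x) (hy : SS k y) :
    PowerSeries.coeff (k + 2) (resw η P e (x + y)) = PowerSeries.coeff (k + 2) (resw η P e x) +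
    Lop e (PowerSeries.coeff (k + 2) (wc e y)) - ((k + 1 : ℕ) : ℂ) • PowerSeries.coeff (k + 1) (wc e y)
      + PowerSeries.coeff (k + 2) (zc e y) := by
  have h := coeff_zero_of_dvd (resw_lin η hP e he hx hy) (m := k + 1 + 1) (by omega)
  simp only [map_sub, map_add, DD_coeff_succ, coeff_cc_mul] at h
  rw [Lop]
  linear_combination h

lemma resz_coeff1 (hP : WOrd 5 P) (he : e * e = 1) (hx : SS 0 x) (hy : SS k y) (hk : 1 ≤ k)
    {α : ℤ → ℂ} (hl : Lead α x) :
    PowerSeries.coeff (k + 2) (resz η P e (x + y)) = PowerSeries.coeff (k + 2) (resz η P e x) +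
    Lop e (PowerSeries.coeff (k + 2) (zc e y)) := by
  have h := coeff_zero_of_dvd (resz_lin η hP e he hk hx hy hl) (m := k + 1 + 1) (by omega)
  have hv := coeff_zero_of_dvd (wc_dvd hy e) (m := k) (by omega)
  have hv' := coeff_zero_of_dvd (wc_dvd hy (-e)) (m := k) (by omega)
  have hu := coeff_zero_of_dvd (zc_dvd hy e) (m := k + 1) (by omega)
  have hX : ∀ f : RR, PowerSeries.coeff (k + 1 + 1) (sX ^ 2 * f) = PowerSeries.coeff k f := fun f => by
    rw [show k + 1 + 1 = k + 2 by ring, PowerSeries.coeff_X_pow_mul]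
  simp only [map_sub, map_add, DD_coeff_succ, coeff_cc_mul, PowerSeries.coeff_C_mul, hX, hv, hv', hu,
    smul_zero, mul_zero, add_zero, sub_zero] at h
  rw [Lop]
  linear_combination h

lemma resz_coeff2 (hP : WOrd 5 P) (he : e * e = 1) (hx : SS 0 x) (hy : SS k y) (hk : 1 ≤ k)
    {α : ℤ → ℂ} (hl : Lead α x) :
    PowerSeries.coeff (k + 3) (resz η P e (x + y)) = PowerSeries.coeff (k + 3) (resz η P e x) +
    Lop e (PowerSeries.coeff (k + 3) (zc e y)) - ((k + 2 : ℕ) : ℂ) • PowerSeries.coeff (k + 2) (zc e y)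
     - LaurentPolynomial.C η * (LaurentPolynomial.C (2 * α e * α (-e)) * PowerSeries.coeff (k + 1) (wc e y)
       + LaurentPolynomial.C (α e ^ 2) * LaurentPolynomial.T (2 * e) * PowerSeries.coeff (k + 1) (wc (-e) y)) := by
  have h := coeff_zero_of_dvd (resz_lin η hP e he hk hx hy hl) (m := k + 2 + 1) (by omega)
  have hX : ∀ f : RR, PowerSeries.coeff (k + 2 + 1) (sX ^ 2 * f) = PowerSeries.coeff (k + 1) f := fun f => by
    rw [show k + 2 + 1 = k + 1 + 2 by ring, PowerSeries.coeff_X_pow_mul]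
  simp only [map_sub, map_add, DD_coeff_succ, coeff_cc_mul, PowerSeries.coeff_C_mul, hX] at h
  rw [Lop]
  linear_combination h

end coeffs

lemma Lop_coeff (e : ℤ) (u : LA) : (Lop e u).coeff e = 0 := dph_sub_coeff e u

lemma Lop_CT (e : ℤ) (a : ℂ) : Lop e (LaurentPolynomial.C a * LaurentPolynomial.T e) = 0 := by
  rw [Lop, dph_CT, map_mul]; ring

lemma C_mul_coeff (a : ℂ) (f : LA) (n : ℤ) : (LaurentPolynomial.C a * f).coeff n = a * f.coeff n := by
  rw [← LaurentPolynomial.smul_eq_C_mul]; rfl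

lemma T_mul_coeff' (m n : ℤ) (a : ℂ) (b : ℂ) (e : ℤ) :
    (LaurentPolynomial.C b * LaurentPolynomial.T (2 * e) * (LaurentPolynomial.C a * LaurentPolynomial.T (-e)) : LA)
     = LaurentPolynomial.C (a * b) * LaurentPolynomial.T e := by
  rw [mul_mul_mul_comm, ← LaurentPolynomial.T_add, ← map_mul, show 2 * e + -e = e by ring, mul_comm a]

/-- Uniqueness step: relations satisfied by the first difference of two solutions. -/
lemma uniq_rel (η : ℂ) {P : MP} (hP : WOrd 5 P) {x y : Fin 4 → RR} {k : ℕ} (hk : 1 ≤ k)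
    (hx : SS 0 x) (hy : SS k y) {α : ℤ → ℂ} (hl : Lead α x)
    (hrx : SS (k + 2) (Res η P x)) (hry : SS (k + 2) (Res η P (x + y))) :
    ∃ a c : ℤ → ℂ, ∀ e : ℤ, e * e = 1 →
      PowerSeries.coeff (k + 1) (wc e y) = LaurentPolynomial.C (a e) * LaurentPolynomial.T e ∧
      PowerSeries.coeff (k + 2) (zc e y) = LaurentPolynomial.C (c e) * LaurentPolynomial.T e ∧
      c e = (k + 1) * a e ∧
      (k + 2) * c e + η * (2 * α e * α (-e) * a e + α e ^ 2 * a (-e)) = 0 := by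
  have zx : ∀ e m, m < k + 4 → PowerSeries.coeff m (resz η P e x) = 0 := fun e m hm =>
    coeff_zero_of_dvd (zc_dvd hrx e) hm
  have wx : ∀ e m, m < k + 3 → PowerSeries.coeff m (resw η P e x) = 0 := fun e m hm =>
    coeff_zero_of_dvd (wc_dvd hrx e) hm
  have zy : ∀ e m, m < k + 4 → PowerSeries.coeff m (resz η P e (x + y)) = 0 := fun e m hm =>
    coeff_zero_of_dvd (zc_dvd hry e) hm
  have wy : ∀ e m, m < k + 3 → PowerSeries.coeff m (resw η P e (x + y)) = 0 := fun e m hm =>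
    coeff_zero_of_dvd (wc_dvd hry e) hm
  have A : ∀ e : ℤ, e * e = 1 → PowerSeries.coeff (k + 1) (wc e y) =
      LaurentPolynomial.C ((PowerSeries.coeff (k + 1) (wc e y)).coeff e) * LaurentPolynomial.T e := by
    intro e he
    have h := resw_coeff1 η e hP he hx hy
    rw [wx e _ (by omega), wy e _ (by omega), zero_add] at h
    exact dph_ker e _ h.symm
  have B : ∀ e : ℤ, e * e = 1 → PowerSeries.coeff (k + 2) (zc e y) =
      LaurentPolynomial.C ((PowerSeries.coeff (k + 2) (zc e y)).coeff e) * LaurentPolynomial.T e := by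
    intro e he
    have h := resz_coeff1 η e hP he hx hy hk hl
    rw [zx e _ (by omega), zy e _ (by omega), zero_add] at h
    exact dph_ker e _ h.symm
  refine ⟨fun e => (PowerSeries.coeff (k + 1) (wc e y)).coeff e,
    fun e => (PowerSeries.coeff (k + 2) (zc e y)).coeff e, fun e he => ⟨A e he, B e he, ?_, ?_⟩⟩
  · have h := resw_coeff2 η e hP he hx hy
    rw [wx e _ (by omega), wy e _ (by omega), zero_add] at h
    have h' := congrArg (fun f : LA => f.coeff e) h
    simp only [AddMonoidAlgebra.coeff_add, AddMonoidAlgebra.coeff_sub, AddMonoidAlgebra.coeff_smul,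
      Finsupp.add_apply, Finsupp.sub_apply, Finsupp.smul_apply, Lop_coeff, AddMonoidAlgebra.coeff_zero,
      Finsupp.zero_apply, smul_eq_mul] at h'
    push_cast at h'
    linear_combination -h'
  · have h := resz_coeff2 η e hP he hx hy hk hl
    have he' : -e * -e = 1 := by simpa using he
    rw [zx e _ (by omega), zy e _ (by omega), zero_add] at h
    have hA' : LaurentPolynomial.C (α e ^ 2) * LaurentPolynomial.T (2 * e) * PowerSeries.coeff (k + 1) (wc (-e) y) =
      LaurentPolynomial.C ((PowerSeries.coeff (k + 1) (wc (-e) y)).coeff (-e) * α e ^ 2) * LaurentPolynomial.T e := by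
      rw [← T_mul_coeff' 0 0, ← A (-e) he']
    rw [hA'] at h
    have h' := congrArg (fun f : LA => f.coeff e) h
    simp only [AddMonoidAlgebra.coeff_add, AddMonoidAlgebra.coeff_sub, AddMonoidAlgebra.coeff_smul,
      Finsupp.add_apply, Finsupp.sub_apply, Finsupp.smul_apply, Lop_coeff, AddMonoidAlgebra.coeff_zero,
      Finsupp.zero_apply, smul_eq_mul, C_mul_coeff, LaurentPolynomial.T_apply, if_true] at h'
    push_cast at h'
    linear_combination h'

lemma dvd_succ_of_coeff {n : ℕ} {f : RR} (h : sX ^ n ∣ f) (h0 : PowerSeries.coeff n f = 0) :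
    sX ^ (n + 1) ∣ f := by
  rw [PowerSeries.X_pow_dvd_iff] at h ⊢
  intro m hm
  rcases Nat.lt_succ_iff_lt_or_eq.mp hm with h1 | rfl
  · exact h m h1
  · exact h0

/-- Uniqueness step, nonresonant case. -/
lemma uniq_step (η : ℂ) {P : MP} (hP : WOrd 5 P) {x y : Fin 4 → RR} {k : ℕ} (hk : 1 ≤ k)
    (hx : SS 0 x) (hy : SS k y) {α : ℤ → ℂ} (hl : Lead α x)
    (hrx : SS (k + 2) (Res η P x)) (hry : SS (k + 2) (Res η P (x + y)))
    (hinj : ∀ a : ℤ → ℂ, (∀ e : ℤ, e * e = 1 → PowerSeries.coeff (k + 1) (wc e y) = LaurentPolynomial.C (a e) * LaurentPolynomial.T e) →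
      (∀ e : ℤ, e * e = 1 →
      (k + 2) * ((k + 1) * a e) + η * (2 * α e * α (-e) * a e + α e ^ 2 * a (-e)) = 0) →
      ∀ e : ℤ, e * e = 1 → a e = 0) : SS (k + 1) y := by
  obtain ⟨a, c, h⟩ := uniq_rel η hP hk hx hy hl hrx hry
  have ha := hinj a (fun e he => (h e he).1) (fun e he => by
    have := (h e he).2.2
    rw [← this.1]; exact this.2)
  apply SS_of_zw
  · intro e he
    have := h e he
    exact dvd_succ_of_coeff (zc_dvd hy e) (by rw [this.2.1, this.2.2.1, ha e he]; simp)
  · intro e he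
    have := h e he
    exact dvd_succ_of_coeff (wc_dvd hy e) (by rw [this.1, ha e he]; simp)

lemma monomial_dvd (k : ℕ) (a b : LA) :
    sX ^ k ∣ sX ^ k * (PowerSeries.C a + sX * PowerSeries.C b) := Dvd.intro _ rfl

lemma monomial_coeff0 (k : ℕ) (a b : LA) :
    PowerSeries.coeff k (sX ^ k * (PowerSeries.C a + sX * PowerSeries.C b)) = a := by
  have := PowerSeries.coeff_X_pow_mul (PowerSeries.C a + sX * PowerSeries.C b) k 0
  rw [zero_add] at this
  rw [this]; simp

lemma monomial_coeff1 (k : ℕ) (a b : LA) :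
    PowerSeries.coeff (k + 1) (sX ^ k * (PowerSeries.C a + sX * PowerSeries.C b)) = b := by
  have := PowerSeries.coeff_X_pow_mul (PowerSeries.C a + sX * PowerSeries.C b) k 1
  rw [add_comm] at this
  rw [this, map_add, PowerSeries.coeff_C, PowerSeries.coeff_succ_X_mul]; simp

/-- Existence step. -/
lemma exists_step (η : ℂ) {P : MP} (hP : WOrd 5 P) {x : Fin 4 → RR} {k : ℕ} (hk : 1 ≤ k)
    (hx : SS 0 x) {α : ℤ → ℂ} (hl : Lead α x) (hrx : SS (k + 1) (Res η P x))
    (a c : ℤ → ℂ)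
    (h1 : ∀ e : ℤ, e * e = 1 → (PowerSeries.coeff (k + 2) (resw η P e x)).coeff e - (k + 1) * a e + c e = 0)
    (h2 : ∀ e : ℤ, e * e = 1 → (PowerSeries.coeff (k + 3) (resz η P e x)).coeff e - (k + 2) * c e
      - η * (2 * α e * α (-e) * a e + α e ^ 2 * a (-e)) = 0) :
    ∃ y, SS k y ∧ SS (k + 2) (Res η P (x + y)) := by
  have hV : ∀ e : ℤ, ∃ V : LA, e * e = 1 → Lop e V = -(PowerSeries.coeff (k + 2) (resw η P e x)
      - LaurentPolynomial.C ((k + 1) * a e) * LaurentPolynomial.T e + LaurentPolynomial.C (c e) * LaurentPolynomial.T e) := by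
    intro e
    by_cases he : e * e = 1
    · obtain ⟨V, hV⟩ := exists_dph_sub e (-(PowerSeries.coeff (k + 2) (resw η P e x)
        - LaurentPolynomial.C ((k + 1) * a e) * LaurentPolynomial.T e + LaurentPolynomial.C (c e) * LaurentPolynomial.T e)) (by
        simp only [AddMonoidAlgebra.coeff_neg, AddMonoidAlgebra.coeff_add, AddMonoidAlgebra.coeff_sub,
          Finsupp.neg_apply, Finsupp.add_apply, Finsupp.sub_apply, CT_coeff, if_true]
        linear_combination -(h1 e he))
      exact ⟨V, fun _ => hV⟩
    · exact ⟨0, fun h => absurd h he⟩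
  have hU : ∀ e : ℤ, ∃ U : LA, e * e = 1 → Lop e U = -(PowerSeries.coeff (k + 3) (resz η P e x)
      - LaurentPolynomial.C ((k + 2) * c e) * LaurentPolynomial.T e
      - LaurentPolynomial.C (η * (2 * α e * α (-e) * a e + α e ^ 2 * a (-e))) * LaurentPolynomial.T e) := by
    intro e
    by_cases he : e * e = 1
    · obtain ⟨V, hV⟩ := exists_dph_sub e (-(PowerSeries.coeff (k + 3) (resz η P e x)
        - LaurentPolynomial.C ((k + 2) * c e) * LaurentPolynomial.T e
        - LaurentPolynomial.C (η * (2 * α e * α (-e) * a e + α e ^ 2 * a (-e))) * LaurentPolynomial.T e)) (by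
        simp only [AddMonoidAlgebra.coeff_neg, AddMonoidAlgebra.coeff_add, AddMonoidAlgebra.coeff_sub,
          Finsupp.neg_apply, Finsupp.add_apply, Finsupp.sub_apply, CT_coeff, if_true]
        linear_combination -(h2 e he))
      exact ⟨V, fun _ => hV⟩
    · exact ⟨0, fun h => absurd h he⟩
  choose V hV using hV
  choose U hU using hU
  obtain ⟨y, hy⟩ := exists_of_zw
    (fun e => sX ^ (k + 2) * (PowerSeries.C (LaurentPolynomial.C (c e) * LaurentPolynomial.T e) + sX * PowerSeries.C (U e)))
    (fun e => sX ^ (k + 1) * (PowerSeries.C (LaurentPolynomial.C (a e) * LaurentPolynomial.T e) + sX * PowerSeries.C (V e)))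
  have hSy : SS k y := by
    apply SS_of_zw
    · intro e he; rw [(hy e he).1]; exact monomial_dvd _ _ _
    · intro e he; rw [(hy e he).2]; exact monomial_dvd _ _ _
  have hw1 : ∀ e : ℤ, e * e = 1 → PowerSeries.coeff (k + 1) (wc e y) = LaurentPolynomial.C (a e) * LaurentPolynomial.T e :=
    fun e he => by rw [(hy e he).2]; exact monomial_coeff0 _ _ _
  have hw2 : ∀ e : ℤ, e * e = 1 → PowerSeries.coeff (k + 2) (wc e y) = V e :=
    fun e he => by rw [(hy e he).2]; exact monomial_coeff1 _ _ _
  have hz1 : ∀ e : ℤ, e * e = 1 → PowerSeries.coeff (k + 2) (zc e y) = LaurentPolynomial.C (c e) * LaurentPolynomial.T e :=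
    fun e he => by rw [(hy e he).1]; exact monomial_coeff0 _ _ _
  have hz2 : ∀ e : ℤ, e * e = 1 → PowerSeries.coeff (k + 3) (zc e y) = U e :=
    fun e he => by rw [(hy e he).1]; exact monomial_coeff1 _ _ _
  refine ⟨y, hSy, ?_⟩
  have hbase : SS k (Res η P (x + y)) := by
    intro i
    have h := Res_sub_dvd η hP (x := x + y) (y := x) (k := k) hx (by simpa using hSy) i
    have h' := (hrx.mono (by omega : k ≤ k + 1)) i
    have := dvd_add h h'
    simpa using this
  apply SS_of_zw
  · intro e he
    show sX ^ (k + 4) ∣ resz η P e (x + y)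
    have zx : ∀ m, m < k + 3 → PowerSeries.coeff m (resz η P e x) = 0 := fun m hm =>
      coeff_zero_of_dvd (zc_dvd hrx e) hm
    refine dvd_succ_of_coeff (dvd_succ_of_coeff (zc_dvd hbase e) ?_) ?_
    · show PowerSeries.coeff (k + 2) (resz η P e (x + y)) = 0
      rw [resz_coeff1 η e hP he hx hSy hk hl, zx _ (by omega), hz1 e he, Lop_CT, zero_add]
    · show PowerSeries.coeff (k + 3) (resz η P e (x + y)) = 0
      rw [resz_coeff2 η e hP he hx hSy hk hl, hz2 e he, hz1 e he, hw1 e he, hw1 (-e) (by simpa using he),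
        hU e he, T_mul_coeff' 0 0, LaurentPolynomial.smul_eq_C_mul]
      simp only [map_mul, map_add, map_pow, map_natCast, Nat.cast_add, Nat.cast_ofNat, map_ofNat]
      ring
  · intro e he
    show sX ^ (k + 3) ∣ resw η P e (x + y)
    have wx : ∀ m, m < k + 2 → PowerSeries.coeff m (resw η P e x) = 0 := fun m hm =>
      coeff_zero_of_dvd (wc_dvd hrx e) hm
    refine dvd_succ_of_coeff (dvd_succ_of_coeff (wc_dvd hbase e) ?_) ?_
    · show PowerSeries.coeff (k + 1) (resw η P e (x + y)) = 0
      rw [resw_coeff1 η e hP he hx hSy, wx _ (by omega), hw1 e he, Lop_CT, zero_add]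
    · show PowerSeries.coeff (k + 2) (resw η P e (x + y)) = 0
      rw [resw_coeff2 η e hP he hx hSy, hw2 e he, hw1 e he, hz1 e he, hV e he, LaurentPolynomial.smul_eq_C_mul]
      simp only [map_mul, map_add, map_natCast, Nat.cast_add, Nat.cast_one, map_one]
      ring


/-! ## Formal existence -/

/-- polynomial truncations of the perturbation -/
structure TruncSeq (P : ℕ → MP) : Prop where
  five : ∀ M, WOrd 5 (P M)
  diff : ∀ M M', M ≤ M' → WOrd M (P M' - P M)

/-- formal solutions -/
def FS (η : ℂ) (P : ℕ → MP) (x : Fin 4 → RR) : Prop :=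
  SS 0 x ∧ ∀ k M, k + 4 ≤ M → SS k (Res η (P M) x)

lemma Res_change (η : ℂ) {P : ℕ → MP} (hP : TruncSeq P) {x : Fin 4 → RR} (hx : SS 0 x) {k M M' : ℕ}
    (hM : k + 4 ≤ M) (hM' : k + 4 ≤ M') (h : SS k (Res η (P M) x)) : SS k (Res η (P M') x) := by
  intro i
  have hw : wt i ≤ 2 := by unfold wt; split_ifs <;> omega
  rcases le_total M M' with hl | hl
  · have := Res_trunc_dvd η (P := P M) (hP.diff M M' hl) hx i
    rw [add_sub_cancel] at this
    have h2 := dvd_add ((pow_dvd_pow sX (by omega : k + wt i ≤ M - 2)).trans this) (h i)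
    simpa using h2
  · have := Res_trunc_dvd η (P := P M') (hP.diff M' M hl) hx i
    rw [add_sub_cancel] at this
    have h2 := dvd_sub (h i) ((pow_dvd_pow sX (by omega : k + wt i ≤ M' - 2)).trans this)
    simpa using h2

lemma Lead.add {α : ℤ → ℂ} {x y : Fin 4 → RR} (h : Lead α x) (hy : SS 1 y) : Lead α (x + y) := by
  intro e he
  rw [wc_add, map_add, h e he, coeff_zero_of_dvd (wc_dvd hy e) (by omega), add_zero]

/-- explicit leading term -/
def x1 (κ : ℂ) : Fin 4 → RR :=
  ![sX ^ 2 * PowerSeries.C (LaurentPolynomial.C κ * lcos), sX ^ 2 * PowerSeries.C (LaurentPolynomial.C κ * lsin),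
    sX ^ 1 * PowerSeries.C (LaurentPolynomial.C κ * lcos), sX ^ 1 * PowerSeries.C (LaurentPolynomial.C κ * lsin)]

def trg : Fin 4 → LA := ![lcos, lsin, lcos, lsin]

lemma x1_eq (κ : ℂ) (i : Fin 4) : x1 κ i = sX ^ (wt i) * PowerSeries.C (LaurentPolynomial.C κ * trg i) := by
  fin_cases i <;> rfl

lemma lcos_lsin (e : ℤ) (he : e * e = 1) :
    lcos + LaurentPolynomial.C (I * e) * lsin = LaurentPolynomial.T e := by
  have h1 : (I * (-I / 2) : ℂ) = 1 / 2 := by linear_combination (-1/2) * I_mul_I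
  have h2 : (I * (I / 2) : ℂ) = -(1 / 2) := by linear_combination (1/2) * I_mul_I
  have h3 : (LaurentPolynomial.C (1/2) : LA) + LaurentPolynomial.C (1/2) = 1 := by
    rw [← map_add]; norm_num
  rcases sq_one_cases he with rfl | rfl
  · simp only [lcos, lsin, Int.cast_one, mul_one, mul_add, ← mul_assoc, ← map_mul, h1, h2, map_neg]
    linear_combination LaurentPolynomial.T 1 * h3
  · simp only [lcos, lsin, Int.cast_one, Int.cast_neg, mul_neg, neg_mul, mul_one, mul_add, ← mul_assoc, ← map_mul,
      h1, h2, map_neg]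
    linear_combination LaurentPolynomial.T (-1) * h3

lemma zc_x1 (κ : ℂ) (e : ℤ) (he : e * e = 1) :
    zc e (x1 κ) = sX ^ 2 * PowerSeries.C (LaurentPolynomial.C κ * LaurentPolynomial.T e) := by
  rw [← lcos_lsin e he]
  show sX ^ 2 * PowerSeries.C (LaurentPolynomial.C κ * lcos) + cc (I * e) *
    (sX ^ 2 * PowerSeries.C (LaurentPolynomial.C κ * lsin)) = _
  rw [cc_eq]; simp only [map_mul, map_add]; ring

lemma wc_x1 (κ : ℂ) (e : ℤ) (he : e * e = 1) :
    wc e (x1 κ) = sX ^ 1 * PowerSeries.C (LaurentPolynomial.C κ * LaurentPolynomial.T e) := by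
  rw [← lcos_lsin e he]
  show sX ^ 1 * PowerSeries.C (LaurentPolynomial.C κ * lcos) + cc (I * e) *
    (sX ^ 1 * PowerSeries.C (LaurentPolynomial.C κ * lsin)) = _
  rw [cc_eq]; simp only [map_mul, map_add]; ring

lemma coeff_XC (k m : ℕ) (a : LA) :
    PowerSeries.coeff m (sX ^ k * PowerSeries.C a) = if m = k then a else 0 := by
  rw [mul_comm, PowerSeries.coeff_C_mul, PowerSeries.coeff_X_pow]; split_ifs <;> simp

lemma DD_mon (k : ℕ) (hk : 1 ≤ k) (a : LA) :
    DD (sX ^ k * PowerSeries.C a) = sX ^ k * PowerSeries.C (dph a) - sX ^ (k + 1) * PowerSeries.C ((k : ℂ) • a) := by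
  ext1 m
  cases m with
  | zero =>
    rw [DD_coeff_zero, map_sub]
    simp only [coeff_XC]
    rw [if_neg (by omega), if_neg (by omega), if_neg (by omega)]; simp
  | succ m =>
    rw [DD_coeff_succ, map_sub]
    simp only [coeff_XC]
    by_cases h : m = k
    · subst h; simp
    · by_cases h' : m + 1 = k
      · simp [h, h']
      · simp [h, h']

lemma SS_x1 (κ : ℂ) : SS 0 (x1 κ) := by
  intro i; rw [x1_eq, zero_add]; exact Dvd.intro _ rfl

lemma Lead_x1 (κ : ℂ) : Lead (fun _ => κ) (x1 κ) := by
  intro e he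
  rw [wc_x1 κ e he, coeff_XC, if_pos rfl]

lemma resw_x1 (η κ : ℂ) (P : MP) (e : ℤ) (he : e * e = 1) : resw η P e (x1 κ) = phw P e (x1 κ) := by
  rw [resw_eq η P e he, wc_x1 κ e he, zc_x1 κ e he, DD_mon 1 le_rfl, dph_CT, cc_eq]
  simp only [map_mul, Nat.cast_one, one_smul]
  ring

lemma resz_x1 (η κ : ℂ) (hκ : η * κ ^ 2 = -2) (P : MP) (e : ℤ) (he : e * e = 1) :
    resz η P e (x1 κ) = - phz P e (x1 κ) := by
  rw [resz_eq η P e he, wc_x1 κ e he, wc_x1 κ (-e) (by simpa using he), zc_x1 κ e he, DD_mon 2 (by omega), dph_CT,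
    cc_eq, cc_eq, LaurentPolynomial.smul_eq_C_mul]
  have hT : (LaurentPolynomial.T e * LaurentPolynomial.T (-e) : LA) = 1 := by
    rw [← LaurentPolynomial.T_add]; simp
  have hT' : (PowerSeries.C (LaurentPolynomial.T e) * PowerSeries.C (LaurentPolynomial.T (-e)) : RR) = 1 := by
    rw [← map_mul, hT, map_one]
  have hk' : (PowerSeries.C (LaurentPolynomial.C η) * PowerSeries.C (LaurentPolynomial.C κ) ^ 2 : RR) = -2 := by
    rw [← map_pow, ← map_pow, ← map_mul, ← map_mul, hκ, map_neg, map_neg, map_ofNat, map_ofNat]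
  simp only [map_mul, Nat.cast_ofNat, map_ofNat]
  linear_combination (-sX ^ 3 * PowerSeries.C (LaurentPolynomial.C η) * PowerSeries.C (LaurentPolynomial.C κ) ^ 3
    * PowerSeries.C (LaurentPolynomial.T e)) * hT' - (sX ^ 3 * PowerSeries.C (LaurentPolynomial.C κ) *
      PowerSeries.C (LaurentPolynomial.T e)) * hk'

lemma phw_dvd {P : MP} (hP : WOrd 5 P) (e : ℤ) {x : Fin 4 → RR} (hx : SS 0 x) : sX ^ 3 ∣ phw P e x :=
  dvd_add (aeval_dvd (hP.pderiv 0) hx) ((aeval_dvd (hP.pderiv 1) hx).mul_left _)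

lemma phz_dvd {P : MP} (hP : WOrd 5 P) (e : ℤ) {x : Fin 4 → RR} (hx : SS 0 x) : sX ^ 4 ∣ phz P e x :=
  dvd_add (aeval_dvd (hP.pderiv 2) hx) ((aeval_dvd (hP.pderiv 3) hx).mul_left _)

lemma Res_x1 (η κ : ℂ) (hκ : η * κ ^ 2 = -2) {P : MP} (hP : WOrd 5 P) : SS 2 (Res η P (x1 κ)) := by
  apply SS_of_zw
  · intro e he
    show _ ∣ resz η P e (x1 κ)
    rw [resz_x1 η κ hκ P e he]
    exact (phz_dvd hP e (SS_x1 κ)).neg_right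
  · intro e he
    show _ ∣ resw η P e (x1 κ)
    rw [resw_x1 η κ P e he]
    exact phw_dvd hP e (SS_x1 κ)

/-! ### solvability at first order -/

lemma rot_trg (i : Fin 4) : rot Real.pi (trg i) = - trg i := by
  have e1 : Complex.exp (((1:ℤ):ℂ) * ((Real.pi : ℂ) * I)) = -1 := by simp
  have e2 : Complex.exp (((-1:ℤ):ℂ) * ((Real.pi : ℂ) * I)) = -1 := by
    simp [Complex.exp_neg]
  have hc : rot Real.pi lcos = - lcos := by
    rw [lcos, map_add, rot_CT, rot_CT, e1, e2]; simp; ring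
  have hs : rot Real.pi lsin = - lsin := by
    rw [lsin, map_add, rot_CT, rot_CT, e1, e2]; simp; ring
  fin_cases i
  · exact hc
  · exact hs
  · exact hc
  · exact hs

lemma trg_odd (m : Fin 4 →₀ ℕ) (h : Odd (∑ i, m i)) : (∏ i, trg i ^ m i : LA).coeff 0 = 0 := by
  have h1 : rot Real.pi (∏ i, trg i ^ m i) = - ∏ i, trg i ^ m i := by
    rw [map_prod]
    simp only [map_pow, rot_trg]
    have : ∀ i, (-trg i) ^ m i = (-1) ^ m i * trg i ^ m i := fun i => by rw [← mul_pow, neg_one_mul]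
    simp only [this, Finset.prod_mul_distrib, Finset.prod_pow_eq_pow_sum, h.neg_one_pow, neg_one_mul]
  have h2 := congrArg (fun f : LA => f.coeff 0) h1
  simp only [rot_coeff, AddMonoidAlgebra.coeff_neg, Finsupp.neg_apply] at h2
  simp only [Int.cast_zero, zero_mul, Complex.exp_zero, one_mul] at h2
  exact self_eq_neg.mp h2

lemma aeval_x1_monomial (κ : ℂ) (m : Fin 4 →₀ ℕ) (a : ℂ) :
    MvPolynomial.aeval (x1 κ) (MvPolynomial.monomial m a) =
      sX ^ mw m * PowerSeries.C (LaurentPolynomial.C (a * κ ^ (∑ i, m i)) * ∏ i, trg i ^ m i) := by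
  rw [MvPolynomial.aeval_monomial, Finsupp.prod_fintype _ _ (by simp)]
  simp only [x1_eq]
  rw [prod_pow_weight]
  show cc a * _ = _
  rw [cc_eq]
  simp only [← map_pow, ← map_prod, mul_pow, Finset.prod_mul_distrib, Finset.prod_pow_eq_pow_sum]
  simp only [map_mul, map_pow]
  ring

lemma solv (κ : ℂ) (P : MP) :
    (PowerSeries.coeff 5 (MvPolynomial.aeval (x1 κ)
      (3 * (MvPolynomial.X 0 * MvPolynomial.pderiv 0 P + MvPolynomial.X 1 * MvPolynomial.pderiv 1 P)
      - (MvPolynomial.X 2 * MvPolynomial.pderiv 2 P + MvPolynomial.X 3 * MvPolynomial.pderiv 3 P)))).coeff 0 = 0 := by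
  induction P using MvPolynomial.induction_on' with
  | add p q hp hq =>
    have := congrArg₂ (· + ·) hp hq
    simp only [add_zero] at this
    rw [← this, ← Finsupp.add_apply, ← AddMonoidAlgebra.coeff_add, ← map_add, ← map_add]
    congr 4
    simp only [map_add]; ring
  | monomial m a =>
    have h0 : (3 * (MvPolynomial.X 0 * MvPolynomial.pderiv 0 (MvPolynomial.monomial m a) + MvPolynomial.X 1 * MvPolynomial.pderiv 1 (MvPolynomial.monomial m a))
      - (MvPolynomial.X 2 * MvPolynomial.pderiv 2 (MvPolynomial.monomial m a) + MvPolynomial.X 3 * MvPolynomial.pderiv 3 (MvPolynomial.monomial m a)) : MP)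
      = MvPolynomial.monomial m ((3 * (m 0 + m 1) - (m 2 + m 3)) * a) := by
      simp only [MvPolynomial.X_mul_pderiv_monomial]
      simp only [nsmul_eq_mul, ← map_natCast (MvPolynomial.C (σ := Fin 4) (R := ℂ)), MvPolynomial.C_mul_monomial]
      rw [← map_add, ← map_add, ← map_ofNat (MvPolynomial.C (σ := Fin 4) (R := ℂ)) 3, MvPolynomial.C_mul_monomial, ← map_sub]
      congr 1
      ring
    rw [h0, aeval_x1_monomial, coeff_XC]
    split_ifs with h
    · rw [C_mul_coeff]
      have hw : 5 = 2 * (m 0 + m 1) + (m 2 + m 3) := by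
        rw [h]; simp [mw, Fin.sum_univ_four, wt]; ring
      by_cases h1 : m 0 + m 1 = 1
      · have h3 : m 2 + m 3 = 3 := by omega
        have : (3 * (m 0 + m 1) - (m 2 + m 3) : ℂ) = 0 := by
          have e1 : (m 0 + m 1 : ℂ) = 1 := by exact_mod_cast h1
          have e3 : (m 2 + m 3 : ℂ) = 3 := by exact_mod_cast h3
          rw [e1, e3]; norm_num
        rw [this]; simp
      · rw [trg_odd, mul_zero]
        rw [Fin.sum_univ_four]
        rw [Nat.odd_iff]
        omega
    · rfl

lemma T_coeff_shift (f : LA) (n : ℤ) : (LaurentPolynomial.T (-n) * f).coeff 0 = f.coeff n := by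
  induction f using LaurentPolynomial.induction_on' with
  | add p q hp hq => simp only [mul_add, AddMonoidAlgebra.coeff_add, Finsupp.add_apply, hp, hq]
  | C_mul_T m a =>
    rw [mul_left_comm, ← LaurentPolynomial.T_add, CT_coeff, CT_coeff]
    congr 1
    simp only [eq_iff_iff]; omega

lemma pair_coeff (u v : LA) :
    (u + LaurentPolynomial.C (I * ((1:ℤ):ℂ)) * v).coeff 1 + (u + LaurentPolynomial.C (I * ((-1:ℤ):ℂ)) * v).coeff (-1)
      = 2 * (lcos * u + lsin * v).coeff 0 := by
  rw [← T_coeff_shift _ 1, ← T_coeff_shift _ (-1), ← Finsupp.add_apply, ← AddMonoidAlgebra.coeff_add,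
    ← C_mul_coeff]
  congr 2
  have h1 : (LaurentPolynomial.C (1/2) : LA) * 2 = 1 := by
    rw [← map_ofNat LaurentPolynomial.C 2, ← map_mul]; norm_num
  have h2 : (LaurentPolynomial.C (I/2) : LA) * 2 = LaurentPolynomial.C I := by
    rw [← map_ofNat LaurentPolynomial.C 2, ← map_mul]; norm_num
  have h3 : (LaurentPolynomial.C (-I/2) : LA) = - LaurentPolynomial.C (I/2) := by
    rw [← map_neg]; congr 1; ring
  simp only [lcos, lsin, Int.cast_one, Int.cast_neg, mul_neg, mul_one, neg_neg, map_neg, map_ofNat, h3]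
  rw [← h2]
  linear_combination -(LaurentPolynomial.T 1 * u + LaurentPolynomial.T (-1) * u) * h1

lemma solv1 {κ : ℂ} (hκ : κ ≠ 0) (P : MP) :
    3 * ((PowerSeries.coeff 3 (phw P 1 (x1 κ))).coeff 1 + (PowerSeries.coeff 3 (phw P (-1) (x1 κ))).coeff (-1))
    - ((PowerSeries.coeff 4 (phz P 1 (x1 κ))).coeff 1 + (PowerSeries.coeff 4 (phz P (-1) (x1 κ))).coeff (-1)) = 0 := by
  have h := solv κ P
  simp only [phw, phz, map_add, coeff_cc_mul]
  have key := pair_coeff (PowerSeries.coeff 3 (MvPolynomial.aeval (x1 κ) (MvPolynomial.pderiv 0 P)))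
    (PowerSeries.coeff 3 (MvPolynomial.aeval (x1 κ) (MvPolynomial.pderiv 1 P)))
  have key2 := pair_coeff (PowerSeries.coeff 4 (MvPolynomial.aeval (x1 κ) (MvPolynomial.pderiv 2 P)))
    (PowerSeries.coeff 4 (MvPolynomial.aeval (x1 κ) (MvPolynomial.pderiv 3 P)))
  rw [key, key2]
  have e0 : ∀ (i : Fin 4) (f : RR) (n : ℕ), PowerSeries.coeff (n + wt i) (x1 κ i * f) =
      LaurentPolynomial.C κ * trg i * PowerSeries.coeff n f := by
    intro i f n
    rw [x1_eq, mul_assoc, PowerSeries.coeff_X_pow_mul, PowerSeries.coeff_C_mul]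
  have h5 : PowerSeries.coeff 5 (MvPolynomial.aeval (x1 κ)
      (3 * (MvPolynomial.X 0 * MvPolynomial.pderiv 0 P + MvPolynomial.X 1 * MvPolynomial.pderiv 1 P)
      - (MvPolynomial.X 2 * MvPolynomial.pderiv 2 P + MvPolynomial.X 3 * MvPolynomial.pderiv 3 P))) =
      LaurentPolynomial.C κ * (LaurentPolynomial.C 3 * (lcos * PowerSeries.coeff 3 (MvPolynomial.aeval (x1 κ) (MvPolynomial.pderiv 0 P))
      + lsin * PowerSeries.coeff 3 (MvPolynomial.aeval (x1 κ) (MvPolynomial.pderiv 1 P)))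
      - (lcos * PowerSeries.coeff 4 (MvPolynomial.aeval (x1 κ) (MvPolynomial.pderiv 2 P))
      + lsin * PowerSeries.coeff 4 (MvPolynomial.aeval (x1 κ) (MvPolynomial.pderiv 3 P)))) := by
    have t0 := e0 0 (MvPolynomial.aeval (x1 κ) (MvPolynomial.pderiv 0 P)) 3
    have t1 := e0 1 (MvPolynomial.aeval (x1 κ) (MvPolynomial.pderiv 1 P)) 3
    have t2 := e0 2 (MvPolynomial.aeval (x1 κ) (MvPolynomial.pderiv 2 P)) 4
    have t3 := e0 3 (MvPolynomial.aeval (x1 κ) (MvPolynomial.pderiv 3 P)) 4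
    have h3 : MvPolynomial.aeval (x1 κ) (3 : MP) = cc 3 := by
      rw [map_ofNat, map_ofNat]
    rw [map_sub, map_mul, map_add, map_add, map_mul, map_mul, map_mul, map_mul, h3]
    simp only [MvPolynomial.aeval_X, map_sub, map_add, coeff_cc_mul]
    change PowerSeries.coeff 5 _ = LaurentPolynomial.C κ * lcos * _ at t0
    change PowerSeries.coeff 5 _ = LaurentPolynomial.C κ * lsin * _ at t1
    change PowerSeries.coeff 5 _ = LaurentPolynomial.C κ * lcos * _ at t2
    change PowerSeries.coeff 5 _ = LaurentPolynomial.C κ * lsin * _ at t3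
    rw [t0, t1, t2, t3]
    ring
  rw [h5, C_mul_coeff, AddMonoidAlgebra.coeff_sub, Finsupp.sub_apply, C_mul_coeff] at h
  have := (mul_eq_zero.mp h).resolve_left hκ
  linear_combination 2 * this


lemma first_step (η κ : ℂ) (hκ : η * κ ^ 2 = -2) {P : MP} (hP : WOrd 5 P) :
    ∃ y, SS 1 y ∧ SS 3 (Res η P (x1 κ + y)) := by
  have hκ0 : κ ≠ 0 := by rintro rfl; norm_num at hκ
  have hs := solv1 hκ0 P
  set rw_ : ℤ → ℂ := fun e => (PowerSeries.coeff 3 (resw η P e (x1 κ))).coeff e with hrw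
  set rz_ : ℤ → ℂ := fun e => (PowerSeries.coeff 4 (resz η P e (x1 κ))).coeff e with hrz
  have hsum : ∀ e : ℤ, e * e = 1 → (rz_ e + 3 * rw_ e) + (rz_ (-e) + 3 * rw_ (-e)) = 0 := by
    have : (rz_ 1 + 3 * rw_ 1) + (rz_ (-1) + 3 * rw_ (-1)) = 0 := by
      simp only [hrw, hrz]
      rw [resw_x1 η κ P 1 (by norm_num), resw_x1 η κ P (-1) (by norm_num), resz_x1 η κ hκ P 1 (by norm_num),
        resz_x1 η κ hκ P (-1) (by norm_num)]
      simp only [map_neg, AddMonoidAlgebra.coeff_neg, Finsupp.neg_apply]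
      linear_combination hs
    intro e he
    rcases sq_one_cases he with rfl | rfl
    · exact this
    · rw [neg_neg]; linear_combination this
  refine exists_step η hP (k := 1) le_rfl (SS_x1 κ) (Lead_x1 κ) (Res_x1 η κ hκ hP)
    (fun e => (rz_ e + 3 * rw_ e) / 4) (fun e => 2 * ((rz_ e + 3 * rw_ e) / 4) - rw_ e) ?_ ?_
  · intro e he
    show rw_ e - _ + _ = 0
    push_cast
    ring
  · intro e he
    show rz_ e - _ - _ = 0
    push_cast
    linear_combination (-(2 * ((rz_ e + 3 * rw_ e) / 4)) - (rz_ (-e) + 3 * rw_ (-e)) / 4) * hκ + (1/2) * hsum e he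

lemma next_step (η κ : ℂ) (hκ : η * κ ^ 2 = -2) {P : MP} (hP : WOrd 5 P) {k : ℕ} (hk : 2 ≤ k)
    {x : Fin 4 → RR} (hx : SS 0 x) (hl : Lead (fun _ => κ) x) (hr : SS (k + 1) (Res η P x)) :
    ∃ y, SS k y ∧ SS (k + 2) (Res η P (x + y)) := by
  set rw_ : ℤ → ℂ := fun e => (PowerSeries.coeff (k + 2) (resw η P e x)).coeff e with hrw
  set rz_ : ℤ → ℂ := fun e => (PowerSeries.coeff (k + 3) (resz η P e x)).coeff e with hrz
  set m : ℂ := (k + 1) * (k + 2) with hm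
  have hd1 : m - 6 ≠ 0 := by
    have : ((k + 1) * (k + 2) : ℕ) ≠ 6 := by
      nlinarith
    intro h
    apply this
    have : (((k + 1) * (k + 2) : ℕ) : ℂ) = (6 : ℕ) := by push_cast; linear_combination h
    exact_mod_cast this
  have hd2 : m - 2 ≠ 0 := by
    have : ((k + 1) * (k + 2) : ℕ) ≠ 2 := by
      nlinarith
    intro h
    apply this
    have : (((k + 1) * (k + 2) : ℕ) : ℂ) = (2 : ℕ) := by push_cast; linear_combination h
    exact_mod_cast this
  set g : ℤ → ℂ := fun e => rz_ e + (k + 2) * rw_ e with hg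
  set a : ℤ → ℂ := fun e => ((m - 4) * g e + 2 * g (-e)) / ((m - 6) * (m - 2)) with ha
  have hrel : ∀ e, (m - 4) * a e - 2 * a (-e) = g e := by
    intro e
    simp only [ha, neg_neg]
    field_simp
    ring
  refine exists_step η hP (by omega) hx hl hr a (fun e => (k + 1) * a e - rw_ e) ?_ ?_
  · intro e he
    show rw_ e - _ + _ = 0
    ring
  · intro e he
    show rz_ e - _ - _ = 0
    have := hrel e
    simp only [hg, hm] at this
    linear_combination -this - (2 * a e + a (-e)) * hκ

/-- existence of a formal solution with given leading coefficient -/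
lemma exists_formal (η κ : ℂ) (hκ : η * κ ^ 2 = -2) {P : ℕ → MP} (hP : TruncSeq P) :
    ∃ x, FS η P x ∧ SS 1 (x - x1 κ) := by
  classical
  let Inv : ℕ → (Fin 4 → RR) → Prop := fun k x => SS 0 x ∧ SS 1 (x - x1 κ) ∧ SS (k + 3) (Res η (P (k + 7)) x)
  have lead : ∀ x, SS 1 (x - x1 κ) → Lead (fun _ => κ) x := by
    intro x hx
    have := (Lead_x1 κ).add hx
    simpa using this
  have step : ∀ k x, Inv k x → ∃ x', Inv (k + 1) x' ∧ SS (k + 2) (x' - x) := by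
    rintro k x ⟨h0, h1, h2⟩
    obtain ⟨y, hy, hy'⟩ := next_step η κ hκ (hP.five (k + 8)) (k := k + 2) (by omega) h0 (lead x h1)
      (Res_change η hP h0 (by omega) (by omega) h2)
    refine ⟨x + y, ⟨h0.add (hy.mono (by omega)), ?_, hy'⟩, by simpa using hy⟩
    have := h1.add (hy.mono (by omega : 1 ≤ k + 2))
    rwa [show x - x1 κ + y = x + y - x1 κ by abel] at this
  have start : ∃ x, Inv 0 x := by
    obtain ⟨y, hy, hy'⟩ := first_step η κ hκ (hP.five 7)
    exact ⟨x1 κ + y, (SS_x1 κ).add (hy.mono (by omega)), by simpa using hy, hy'⟩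
  obtain ⟨s0, hs0⟩ := start
  choose nx hnx hnx' using step
  let f : ∀ k, {x // Inv k x} := fun k => Nat.rec ⟨s0, hs0⟩ (fun k x => ⟨nx k x.1 x.2, hnx k x.1 x.2⟩) k
  have hf : ∀ k, SS (k + 2) ((f (k + 1)).1 - (f k).1) := fun k => hnx' k (f k).1 (f k).2
  have hf' : ∀ k j, SS (k + 2) ((f (k + j)).1 - (f k).1) := by
    intro k j
    induction j with
    | zero => intro i; simp
    | succ j ih =>
      have := ih.add ((hf (k + j)).mono (by omega : k + 2 ≤ k + j + 2))
      rwa [show (f (k + j)).1 - (f k).1 + ((f (k + j + 1)).1 - (f (k + j)).1) = (f (k + (j + 1))).1 - (f k).1 by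
        rw [← add_assoc]; abel] at this
  let x : Fin 4 → RR := fun i => PowerSeries.mk fun n => PowerSeries.coeff n ((f n).1 i)
  have hx : ∀ n, SS (n + 2) (x - (f n).1) := by
    intro n i
    rw [PowerSeries.X_pow_dvd_iff]
    intro m hm
    rw [Pi.sub_apply, map_sub, PowerSeries.coeff_mk, sub_eq_zero]
    rcases le_total n m with h | h
    · obtain ⟨j, rfl⟩ := Nat.exists_eq_add_of_le h
      exact coeff_eq_of_dvd (hf' n j i) hm
    · obtain ⟨j, rfl⟩ := Nat.exists_eq_add_of_le h
      exact (coeff_eq_of_dvd (hf' m j i) (by omega)).symm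
  have hx0 : SS 0 x := by
    have := ((hx 0).mono (Nat.zero_le _)).add (f 0).2.1
    simpa using this
  refine ⟨x, ⟨hx0, ?_⟩, ?_⟩
  · intro k M hM
    have h1 : SS k (Res η (P M) (f (k + M)).1) :=
      Res_change η hP (f (k + M)).2.1 (by omega) (by omega) ((f (k + M)).2.2.2.mono (by omega : k ≤ k + M + 3))
    intro i
    have h2 := Res_sub_dvd η (hP.five M) (f (k + M)).2.1 ((hx (k + M)).mono (by omega : k ≤ k + M + 2)) i
    have := dvd_add h2 (h1 i)
    simpa using this
  · have := ((hx 0).mono (by omega : 1 ≤ 0 + 2)).add (f 0).2.2.1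
    simpa using this


/-! ## Translations acting on formal series -/

/-- re-expansion coefficients of `(τ + τ₀) ^ (-j)` -/
def sc (τ₀ : ℂ) : ℕ → ℕ → ℂ
  | 0, 0 => 1
  | 0, (_ + 1) => 0
  | (_ + 1), 0 => 0
  | (k + 1), (j + 1) => sc τ₀ k j - τ₀ * sc τ₀ k (j + 1)

lemma sc_gt (τ₀ : ℂ) (k j : ℕ) (h : k < j) : sc τ₀ k j = 0 := by
  induction k generalizing j with
  | zero => cases j with
    | zero => omega
    | succ j => rfl
  | succ k ih => cases j with
    | zero => omega
    | succ j => rw [sc, ih j (by omega), ih (j + 1) (by omega)]; simp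

lemma sc_diag (τ₀ : ℂ) (k : ℕ) : sc τ₀ k k = 1 := by
  induction k with
  | zero => rfl
  | succ k ih => rw [sc, ih, sc_gt _ _ _ (by omega)]; simp

lemma sc_mul (τ₀ : ℂ) (k j : ℕ) : (k : ℂ) * sc τ₀ k j = j * sc τ₀ (k + 1) (j + 1) := by
  induction k generalizing j with
  | zero => cases j with
    | zero => simp
    | succ j => rw [sc_gt _ (0 + 1) _ (by omega)]; simp
  | succ k ih => cases j with
    | zero => simp [sc]
    | succ j =>
      have h1 := ih j
      have h2 := ih (j + 1)
      have e1 : sc τ₀ (k + 1) (j + 1) = sc τ₀ k j - τ₀ * sc τ₀ k (j + 1) := rfl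
      have e2 : sc τ₀ (k + 1 + 1) (j + 1 + 1) = sc τ₀ (k + 1) (j + 1) - τ₀ * sc τ₀ (k + 1) (j + 1 + 1) := rfl
      rw [e2]
      push_cast at h2 ⊢
      linear_combination h1 - τ₀ * h2 + (k : ℂ) * e1

lemma sc_eq (τ₀ : ℂ) (k j : ℕ) (h : j ≤ k) :
    sc τ₀ k j = (-1 : ℂ) ^ (k - j) * ((k-1).choose (k - j) : ℂ) * τ₀ ^ (k - j) := by
  induction k generalizing j with
  | zero => obtain rfl : j = 0 := by omega
            simp [sc]
  | succ k ih => cases j with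
    | zero => simp [sc]
    | succ j =>
      rcases Nat.eq_or_lt_of_le h with h' | h'
      · obtain rfl : j = k := by omega
        rw [sc_diag]; simp
      · obtain ⟨n, rfl⟩ : ∃ n, k = j + n + 1 := ⟨k - j - 1, by omega⟩
        rw [sc, ih j (by omega), ih (j + 1) (by omega)]
        have e1 : j + n + 1 - j = n + 1 := by omega
        have e2 : j + n + 1 - (j + 1) = n := by omega
        have e3 : j + n + 1 + 1 - (j + 1) = n + 1 := by omega
        rw [e1, e2, e3]
        simp only [Nat.add_sub_cancel]
        rw [Nat.choose_succ_succ]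
        push_cast
        ring

/-- the series `s / (1 + τ₀ s)` -/
def gs (τ₀ : ℂ) : RR := PowerSeries.mk fun k => LaurentPolynomial.C (sc τ₀ k 1)

lemma gs_mul (τ₀ : ℂ) : gs τ₀ + sX * (cc τ₀ * gs τ₀) = sX := by
  ext1 m
  rw [map_add]
  cases m with
  | zero =>
    rw [PowerSeries.coeff_zero_X_mul, gs, PowerSeries.coeff_mk]; simp [sc]
  | succ m =>
    rw [PowerSeries.coeff_succ_X_mul, coeff_cc_mul, gs, PowerSeries.coeff_mk, PowerSeries.coeff_mk]
    rw [← map_mul, ← map_add, PowerSeries.coeff_X]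
    have : sc τ₀ (m + 1) 1 = sc τ₀ m 0 - τ₀ * sc τ₀ m 1 := rfl
    rw [this, sub_add_cancel]
    cases m with
    | zero => simp [sc]
    | succ m => simp [sc]

lemma gs_pow_coeff (τ₀ : ℂ) (k j : ℕ) : PowerSeries.coeff k (gs τ₀ ^ j) = LaurentPolynomial.C (sc τ₀ k j) := by
  have hrec : ∀ j, gs τ₀ ^ (j + 1) + sX * (cc τ₀ * gs τ₀ ^ (j + 1)) = sX * gs τ₀ ^ j := by
    intro j
    rw [pow_succ]
    linear_combination (gs τ₀ ^ j) * gs_mul τ₀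
  induction k generalizing j with
  | zero => cases j with
    | zero => simp [sc]
    | succ j =>
      have := congrArg (PowerSeries.coeff 0) (hrec j)
      rw [map_add, PowerSeries.coeff_zero_X_mul, PowerSeries.coeff_zero_X_mul, add_zero] at this
      rw [this]; simp [sc]
  | succ k ih => cases j with
    | zero => rw [pow_zero, PowerSeries.coeff_one]; simp [sc]
    | succ j =>
      have := congrArg (PowerSeries.coeff (k + 1)) (hrec j)
      rw [map_add, PowerSeries.coeff_succ_X_mul, PowerSeries.coeff_succ_X_mul, coeff_cc_mul, ih, ih] at this
      rw [sc, map_sub, map_mul]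
      linear_combination this

lemma gs_subst (τ₀ : ℂ) : PowerSeries.HasSubst (gs τ₀) := by
  apply PowerSeries.HasSubst.of_constantCoeff_zero'
  rw [← PowerSeries.coeff_zero_eq_constantCoeff_apply, gs, PowerSeries.coeff_mk]; simp [sc]

def sig (φ₀ τ₀ : ℂ) : RR →+* RR :=
  (PowerSeries.substAlgHom (R := LA) (gs_subst τ₀)).toRingHom.comp (PowerSeries.map (rot φ₀).toRingHom)

lemma sig_coeff (φ₀ τ₀ : ℂ) (f : RR) (k : ℕ) : PowerSeries.coeff k (sig φ₀ τ₀ f) =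
    ∑ j ∈ Finset.range (k + 1), sc τ₀ k j • rot φ₀ (PowerSeries.coeff j f) := by
  show PowerSeries.coeff k (PowerSeries.substAlgHom (R := LA) (gs_subst τ₀) (PowerSeries.map (rot φ₀).toRingHom f)) = _
  rw [PowerSeries.coe_substAlgHom, PowerSeries.coeff_subst' (gs_subst τ₀)]
  rw [finsum_eq_sum_of_support_subset (s := Finset.range (k + 1))]
  · apply Finset.sum_congr rfl
    intro j _
    rw [gs_pow_coeff, PowerSeries.coeff_map, LaurentPolynomial.smul_eq_C_mul, smul_eq_mul, mul_comm]
    rfl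
  · intro j hj
    rw [Function.mem_support, gs_pow_coeff] at hj
    simp only [Finset.coe_range, Set.mem_Iio]
    by_contra h
    apply hj
    rw [sc_gt _ _ _ (by omega)]; simp

lemma sig_cc (φ₀ τ₀ a : ℂ) : sig φ₀ τ₀ (cc a) = cc a := by
  ext1 k
  rw [sig_coeff, cc_eq, Finset.sum_eq_single 0]
  · cases k with
    | zero => simp [sc, PowerSeries.coeff_C]; exact (rot φ₀).commutes a
    | succ k => simp [sc, PowerSeries.coeff_C]
  · intro j _ hj; rw [PowerSeries.coeff_C, if_neg hj]; simp
  · simp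

def sigA (φ₀ τ₀ : ℂ) : RR →ₐ[ℂ] RR := { sig φ₀ τ₀ with commutes' := sig_cc φ₀ τ₀ }

lemma sigA_apply (φ₀ τ₀ : ℂ) (f : RR) : sigA φ₀ τ₀ f = sig φ₀ τ₀ f := rfl

lemma sig_dvd (φ₀ τ₀ : ℂ) {n : ℕ} {f : RR} (h : sX ^ n ∣ f) : sX ^ n ∣ sig φ₀ τ₀ f := by
  rw [PowerSeries.X_pow_dvd_iff] at h ⊢
  intro m hm
  rw [sig_coeff]
  apply Finset.sum_eq_zero
  intro j hj
  rw [h j (by simp at hj; omega)]; simp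

lemma sig_DD (φ₀ τ₀ : ℂ) (f : RR) : DD (sig φ₀ τ₀ f) = sig φ₀ τ₀ (DD f) := by
  ext1 k
  cases k with
  | zero => rw [DD_coeff_zero, sig_coeff, sig_coeff]; simp [sc, DD_coeff_zero, dph_rot]
  | succ k =>
    rw [DD_coeff_succ, sig_coeff, sig_coeff, sig_coeff]
    rw [Finset.sum_range_succ' _ (k + 1), Finset.sum_range_succ' _ (k + 1)]
    simp only [sc, zero_smul, add_zero]
    have e1 : ∀ j, (sc τ₀ k j - τ₀ * sc τ₀ k (j + 1)) = sc τ₀ (k + 1) (j + 1) := fun j => rfl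
    simp only [e1, DD_coeff_succ, map_sum, Finset.smul_sum]
    rw [← Finset.sum_sub_distrib]
    apply Finset.sum_congr rfl
    intro j _
    rw [map_sub, map_smul, map_smul, smul_sub, dph_rot, smul_smul, smul_smul, sc_mul, mul_comm]

def shx (φ₀ τ₀ : ℂ) (x : Fin 4 → RR) : Fin 4 → RR := fun i => sig φ₀ τ₀ (x i)

lemma Res_shx (η : ℂ) (P : MP) (φ₀ τ₀ : ℂ) (x : Fin 4 → RR) (i : Fin 4) :
    Res η P (shx φ₀ τ₀ x) i = sig φ₀ τ₀ (Res η P x i) := by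
  have := MvPolynomial.comp_aeval_apply (B := RR) (f := x) (sigA φ₀ τ₀) (Yv η P i)
  rw [Res, Res, map_sub, ← sig_DD, ← sigA_apply φ₀ τ₀ (MvPolynomial.aeval _ _), this]
  rfl

lemma FS_shx (η : ℂ) {P : ℕ → MP} {x : Fin 4 → RR} (h : FS η P x) (φ₀ τ₀ : ℂ) : FS η P (shx φ₀ τ₀ x) := by
  refine ⟨fun i => sig_dvd _ _ (h.1 i), fun k M hM i => ?_⟩
  rw [Res_shx]
  exact sig_dvd _ _ (h.2 k M hM i)


/-! ## Formal uniqueness -/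

lemma lead_rel (η : ℂ) {P : MP} (hP : WOrd 5 P) {y : Fin 4 → RR} (hy : SS 0 y) (hr : SS 2 (Res η P y)) :
    ∃ α : ℤ → ℂ, Lead α y ∧ ∀ e : ℤ, e * e = 1 →
      PowerSeries.coeff 2 (zc e y) = LaurentPolynomial.C (α e) * LaurentPolynomial.T e ∧
      -2 * α e = η * (α e ^ 2 * α (-e)) := by
  have hw0 : ∀ e, PowerSeries.coeff 0 (wc e y) = 0 := fun e => coeff_zero_of_dvd (wc_dvd hy e) (by omega)
  have hz1 : ∀ e, PowerSeries.coeff 1 (zc e y) = 0 := fun e => coeff_zero_of_dvd (zc_dvd hy e) (by omega)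
  have hl : Lead (fun e => (PowerSeries.coeff 1 (wc e y)).coeff e) y := by
    intro e he
    have h := coeff_zero_of_dvd (wc_dvd hr e) (m := 0 + 1) (by omega)
    change PowerSeries.coeff (0 + 1) (resw η P e y) = 0 at h
    rw [resw_eq η P e he] at h
    have hp := coeff_zero_of_dvd (phw_dvd hP e hy) (m := 0 + 1) (by omega)
    simp only [map_add, map_sub, DD_coeff_succ, coeff_cc_mul, hw0, hp] at h
    rw [zero_add, hz1 e] at h
    simp only [smul_zero, sub_zero, add_zero] at h
    exact dph_ker e _ h
  refine ⟨_, hl, fun e he => ?_⟩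
  have he' : -e * -e = 1 := by simpa using he
  obtain ⟨r, hr1⟩ := wc_lead hy hl e he
  obtain ⟨r', hr1'⟩ := wc_lead hy hl (-e) he'
  have hz := hl e he
  have hz' := hl (-e) he'
  simp only at hz hz' hr1 hr1'
  rw [← hz] at hr1
  rw [← hz'] at hr1'
  set A := PowerSeries.coeff 1 (wc e y) with hA
  set B := PowerSeries.coeff 1 (wc (-e) y) with hB
  have hcub : wc e y ^ 2 * wc (-e) y = sX ^ 3 * (PowerSeries.C (A ^ 2 * B) + sX * ((2 * PowerSeries.C A * r + sX * r ^ 2) * PowerSeries.C B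
      + (PowerSeries.C A + sX * r) ^ 2 * r')) := by
    rw [hr1, hr1']; simp only [map_mul, map_pow]; ring
  have hc3 : PowerSeries.coeff 3 (wc e y ^ 2 * wc (-e) y) = A ^ 2 * B := by
    rw [hcub]
    have := PowerSeries.coeff_X_pow_mul (PowerSeries.C (A ^ 2 * B) + sX * ((2 * PowerSeries.C A * r + sX * r ^ 2) * PowerSeries.C B
      + (PowerSeries.C A + sX * r) ^ 2 * r')) 3 0
    rw [zero_add] at this
    rw [this]; simp
  have hc2 : PowerSeries.coeff 2 (wc e y ^ 2 * wc (-e) y) = 0 := by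
    rw [hcub]; exact coeff_zero_of_dvd (Dvd.intro _ rfl) (by omega)
  have hA2B : A ^ 2 * B = LaurentPolynomial.C (A.coeff e ^ 2 * B.coeff (-e)) * LaurentPolynomial.T e := by
    conv_lhs => rw [hz, hz']
    rw [mul_pow, LaurentPolynomial.T_pow, ← map_pow, mul_mul_mul_comm, ← map_mul, ← LaurentPolynomial.T_add]
    congr 2; push_cast; ring
  have q2 := coeff_zero_of_dvd (wc_dvd hr e) (m := 1 + 1) (by omega)
  change PowerSeries.coeff (1 + 1) (resw η P e y) = 0 at q2
  rw [resw_eq η P e he] at q2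
  have hp2 := coeff_zero_of_dvd (phw_dvd hP e hy) (m := 1 + 1) (by omega)
  simp only [map_add, map_sub, DD_coeff_succ, coeff_cc_mul, hp2, ← hA] at q2
  have z2 := coeff_zero_of_dvd (zc_dvd hr e) (m := 1 + 1) (by omega)
  change PowerSeries.coeff (1 + 1) (resz η P e y) = 0 at z2
  rw [resz_eq η P e he] at z2
  have hp3 := coeff_zero_of_dvd (phz_dvd hP e hy) (m := 1 + 1) (by omega)
  simp only [map_sub, DD_coeff_succ, coeff_cc_mul, hp3, hz1, smul_zero, sub_zero] at z2
  simp only [show 1 + 1 = 2 from rfl, hc2, mul_zero, sub_zero] at z2 q2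
  have z3 := coeff_zero_of_dvd (zc_dvd hr e) (m := 2 + 1) (by omega)
  change PowerSeries.coeff (2 + 1) (resz η P e y) = 0 at z3
  rw [resz_eq η P e he] at z3
  have hp4 := coeff_zero_of_dvd (phz_dvd hP e hy) (m := 2 + 1) (by omega)
  simp only [map_sub, DD_coeff_succ, coeff_cc_mul, hp4, sub_zero] at z3
  simp only [show 2 + 1 = 3 from rfl, hc3, hA2B] at z3
  have hzz := dph_ker e _ z2
  have q2' := congrArg (fun f : LA => f.coeff e) q2
  have L2 := dph_sub_coeff e (PowerSeries.coeff 2 (wc e y))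
  have L3 := dph_sub_coeff e (PowerSeries.coeff 3 (zc e y))
  have z3' := congrArg (fun f : LA => f.coeff e) z3
  simp only [AddMonoidAlgebra.coeff_add, AddMonoidAlgebra.coeff_sub, AddMonoidAlgebra.coeff_smul,
      Finsupp.add_apply, Finsupp.sub_apply, Finsupp.smul_apply, AddMonoidAlgebra.coeff_zero,
      Finsupp.zero_apply, smul_eq_mul, C_mul_coeff, LaurentPolynomial.T_apply, if_true] at q2' z3' L2 L3
  have hca : (PowerSeries.coeff 2 (zc e y)).coeff e = A.coeff e := by
    push_cast at q2'
    linear_combination q2' - L2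
  rw [hca] at hzz z3'
  refine ⟨hzz, ?_⟩
  push_cast at z3'
  linear_combination z3' - L3

lemma eq_of_SS {x : Fin 4 → RR} (h : ∀ k, SS k x) : x = 0 := by
  funext i
  ext1 m
  rw [coeff_zero_of_dvd (h (m + 1) i) (by omega)]; simp

lemma Res_zero (η : ℂ) {P : MP} (hP : WOrd 5 P) : Res η P 0 = 0 := by
  funext i
  rw [Res]
  have : MvPolynomial.aeval (0 : Fin 4 → RR) (Yv η P i) = 0 := by
    rw [MvPolynomial.aeval_zero]
    have : MvPolynomial.constantCoeff (Yv η P i) = 0 := by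
      by_contra h
      have := WOrd_Yv η hP i 0 h
      have h0 : mw 0 = 0 := by simp [mw]
      have : 1 ≤ wt i := by unfold wt; split_ifs <;> omega
      omega
    rw [this, map_zero]
  rw [this]; simp

lemma lead_zero {η : ℂ} {P : ℕ → MP} (hP : TruncSeq P) {y : Fin 4 → RR} (hy : FS η P y)
    {α : ℤ → ℂ} (hl : Lead α y) (hz : ∀ e : ℤ, e * e = 1 →
      PowerSeries.coeff 2 (zc e y) = LaurentPolynomial.C (α e) * LaurentPolynomial.T e)
    (h0 : ∀ e : ℤ, e * e = 1 → α e = 0) : y = 0 := by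
  have h1 : SS 1 y := by
    apply SS_of_zw
    · intro e he
      exact dvd_succ_of_coeff (zc_dvd hy.1 e) (by rw [hz e he, h0 e he]; simp)
    · intro e he
      exact dvd_succ_of_coeff (wc_dvd hy.1 e) (by rw [hl e he, h0 e he]; simp)
  have h2 : ∀ k, SS (k + 1) y := by
    intro k
    induction k with
    | zero => exact h1
    | succ k ih =>
      refine uniq_step η (hP.five (k + 7)) (x := 0) (α := fun _ => 0) (by omega) (fun i => by simp) ih ?_ ?_ ?_ ?_
      · intro e he; simp [wc]
      · rw [Res_zero η (hP.five _)]; intro i; simp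
      · rw [zero_add]; exact hy.2 _ _ (by omega)
      · intro a _ ha e he
        have := ha e he
        simp only [mul_zero, zero_mul, ne_eq, OfNat.ofNat_ne_zero, not_false_eq_true, zero_pow, add_zero] at this
        rcases mul_eq_zero.mp this with h | h
        · exact absurd h (by norm_cast)
        · rcases mul_eq_zero.mp h with h | h
          · exact absurd h (by norm_cast)
          · exact h
  exact eq_of_SS fun k => (h2 k).mono (by omega)

lemma wc_shx (φ₀ τ₀ : ℂ) (e : ℤ) (x : Fin 4 → RR) : wc e (shx φ₀ τ₀ x) = sig φ₀ τ₀ (wc e x) := by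
  simp only [wc, shx, map_add, map_mul, sig_cc]

lemma formal_unique {η κ : ℂ} (hκ : η * κ ^ 2 = -2) {P : ℕ → MP} (hP : TruncSeq P) {x y : Fin 4 → RR}
    (hx : FS η P x) (hx1 : SS 1 (x - x1 κ)) (hy : FS η P y) (hy0 : y ≠ 0) :
    ∃ φ₀ τ₀ : ℂ, y = shx φ₀ τ₀ x := by
  have hκ0 : κ ≠ 0 := by rintro rfl; norm_num at hκ
  have hη0 : η ≠ 0 := by rintro rfl; norm_num at hκ
  obtain ⟨α, hl, hα⟩ := lead_rel η (hP.five 6) hy.1 (hy.2 2 6 (by norm_num))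
  have hα1 : α 1 ≠ 0 := by
    intro h
    apply hy0
    refine lead_zero hP hy hl (fun e he => (hα e he).1) ?_
    intro e he
    rcases sq_one_cases he with rfl | rfl
    · exact h
    · have := (hα (-1) (by norm_num)).2
      rw [neg_neg, h] at this
      linear_combination (-1/2) * this
  have hprod1 : η * (α 1 * α (-1)) = -2 := by
    have := (hα 1 (by norm_num)).2
    apply mul_left_cancel₀ hα1
    linear_combination -this
  have hprod : ∀ e : ℤ, e * e = 1 → η * (α e * α (-e)) = -2 := by
    intro e he
    rcases sq_one_cases he with rfl | rfl
    · exact hprod1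
    · rw [neg_neg]; linear_combination hprod1
  have hlx : Lead (fun _ => κ) x := by
    have := (Lead_x1 κ).add hx1
    simpa using this
  set φ₀ : ℂ := Complex.log (α 1 / κ) / I with hφ
  have hexp : Complex.exp (φ₀ * I) = α 1 / κ := by
    rw [hφ, div_mul_cancel₀ _ I_ne_zero, Complex.exp_log (div_ne_zero hα1 hκ0)]
  set τ₀ : ℂ := ((rot φ₀ (PowerSeries.coeff 2 (wc 1 x))).coeff 1 - (PowerSeries.coeff 2 (wc 1 y)).coeff 1) / α 1 with hτ
  refine ⟨φ₀, τ₀, ?_⟩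
  set x' := shx φ₀ τ₀ x with hx'
  have hFx' : FS η P x' := FS_shx η hx φ₀ τ₀
  have hw1 : ∀ e : ℤ, PowerSeries.coeff 1 (wc e x') = rot φ₀ (PowerSeries.coeff 1 (wc e x)) := by
    intro e
    rw [hx', wc_shx, sig_coeff]
    simp [Finset.sum_range_succ, sc]
  have hw2 : PowerSeries.coeff 2 (wc 1 x') = rot φ₀ (PowerSeries.coeff 2 (wc 1 x)) - τ₀ • PowerSeries.coeff 1 (wc 1 x') := by
    rw [hw1, hx', wc_shx, sig_coeff]
    simp [Finset.sum_range_succ, sc]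
    abel
  have hl' : Lead α x' := by
    intro e he
    rw [hw1, hlx e he, rot_CT]
    congr 2
    rcases sq_one_cases he with rfl | rfl
    · simp only [Int.cast_one, one_mul, hexp]; field_simp
    · simp only [Int.cast_neg, Int.cast_one, neg_mul, one_mul, Complex.exp_neg, hexp]
      have h3 : κ ^ 2 = α 1 * α (-1) := by
        apply mul_left_cancel₀ hη0
        linear_combination hκ - hprod1
      field_simp
      linear_combination h3
  obtain ⟨β, hlβ, hβ⟩ := lead_rel η (hP.five 6) hFx'.1 (hFx'.2 2 6 (by norm_num))
  have hβα : ∀ e : ℤ, e * e = 1 → β e = α e := by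
    intro e he
    have h := (hlβ e he).symm.trans (hl' e he)
    have := congrArg (fun f : LA => f.coeff e) h
    simpa only [CT_coeff, if_true] using this
  have hwsub : ∀ e u v, wc e (u - v) = wc e u - wc e v := by intro e u v; simp [wc]; ring
  have hzsub : ∀ e u v, zc e (u - v) = zc e u - zc e v := by intro e u v; simp [zc]; ring
  have hd0 : SS 0 (y - x') := hy.1.sub hFx'.1
  have hd1 : SS 1 (y - x') := by
    apply SS_of_zw
    · intro e he
      exact dvd_succ_of_coeff (zc_dvd hd0 e) (by
        rw [hzsub, map_sub, (hα e he).1, (hβ e he).1, hβα e he, sub_self])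
    · intro e he
      exact dvd_succ_of_coeff (wc_dvd hd0 e) (by
        rw [hwsub, map_sub, hl e he, hl' e he, sub_self])
  have hd2 : SS 2 (y - x') := by
    refine uniq_step η (hP.five 7) le_rfl hFx'.1 hd1 hl' (hFx'.2 _ _ (by norm_num))
      (by rw [add_sub_cancel]; exact hy.2 _ _ (by norm_num)) ?_
    intro a ha hrel
    have ha1 : a 1 = 0 := by
      have h := ha 1 (by norm_num)
      rw [hwsub, map_sub, show 1 + 1 = 2 from rfl, hw2, hl' 1 (by norm_num)] at h
      have := congrArg (fun f : LA => f.coeff 1) h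
      simp only [AddMonoidAlgebra.coeff_sub, AddMonoidAlgebra.coeff_smul,
        Finsupp.sub_apply, Finsupp.smul_apply, smul_eq_mul, CT_coeff, if_true] at this
      rw [← this, hτ]
      field_simp
      ring
    have ham : a (-1) = 0 := by
      have h := hrel 1 (by norm_num)
      rw [ha1] at h
      have h' : η * α 1 ^ 2 * a (-1) = 0 := by linear_combination h
      exact (mul_eq_zero.mp h').resolve_left (mul_ne_zero hη0 (pow_ne_zero _ hα1))
    intro e he
    rcases sq_one_cases he with rfl | rfl
    · exact ha1
    · exact ham
  have hdk : ∀ k, SS (k + 2) (y - x') := by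
    intro k
    induction k with
    | zero => exact hd2
    | succ k ih =>
      refine uniq_step η (hP.five (k + 8)) (by omega) hFx'.1 ih hl' (hFx'.2 _ _ (by omega))
        (by rw [add_sub_cancel]; exact hy.2 _ _ (by omega)) ?_
      intro a _ hrel e he
      have h1 := hrel e he
      have h2 := hrel (-e) (by simpa using he)
      rw [neg_neg] at h2
      have hp := hprod e he
      push_cast at h1 h2
      set m : ℂ := ((k:ℂ) + 2 + 2) * ((k:ℂ) + 2 + 1) with hm
      have h1' : (m - 4) * a e + η * α e ^ 2 * a (-e) = 0 := by
        linear_combination h1 - 2 * a e * hp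
      have h2' : (m - 4) * a (-e) + η * α (-e) ^ 2 * a e = 0 := by
        linear_combination h2 - 2 * a (-e) * hp
      have h3 : ((m - 6) * (m - 2)) * a e = 0 := by
        linear_combination (m - 4) * h1' - η * α e ^ 2 * h2' + (η * (α e * α (-e)) - 2) * a e * hp
      refine (mul_eq_zero.mp h3).resolve_left ?_
      have hm' : m = (((k + 4) * (k + 3) : ℕ) : ℂ) := by rw [hm]; push_cast; ring
      apply mul_ne_zero
      · rw [sub_ne_zero, hm']
        intro h
        have : (k + 4) * (k + 3) = 6 := by exact_mod_cast h
        nlinarith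
      · rw [sub_ne_zero, hm']
        intro h
        have : (k + 4) * (k + 3) = 2 := by exact_mod_cast h
        nlinarith
  have := eq_of_SS fun k => (hdk k).mono (by omega)
  exact sub_eq_zero.mp this


/-! ## Taylor polynomials of the perturbation -/

lemma poly_growth (R : Polynomial ℂ) (C : ℝ) (m : ℕ)
    (h : ∀ᶠ s : ℝ in nhdsWithin (0:ℝ) (Ioi 0), ‖R.eval (s:ℂ)‖ ≤ C * s ^ m) : (Polynomial.X : Polynomial ℂ) ^ m ∣ R := by
  induction m generalizing C with
  | zero => simp
  | succ m ih =>
    have hlt : ∀ᶠ s : ℝ in nhdsWithin (0:ℝ) (Ioi 0), 0 < s ∧ s < 1 := by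
      filter_upwards [Ioo_mem_nhdsGT (zero_lt_one' ℝ)] with s hs using hs
    have h1 : ∀ᶠ s : ℝ in nhdsWithin (0:ℝ) (Ioi 0), ‖R.eval (s:ℂ)‖ ≤ |C| * s ^ (m+1) := by
      filter_upwards [h, hlt] with s hs h0
      exact hs.trans (mul_le_mul_of_nonneg_right (le_abs_self C) (pow_nonneg h0.1.le _))
    have ih' : (Polynomial.X : Polynomial ℂ) ^ m ∣ R := by
      refine ih |C| ?_
      filter_upwards [h1, hlt] with s hs h0
      refine hs.trans (mul_le_mul_of_nonneg_left ?_ (abs_nonneg C))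
      exact pow_le_pow_of_le_one h0.1.le h0.2.le (Nat.le_succ m)
    obtain ⟨Q, rfl⟩ := ih'
    rw [pow_succ]
    refine mul_dvd_mul_left _ ?_
    rw [Polynomial.X_dvd_iff, Polynomial.coeff_zero_eq_eval_zero]
    have hc : Tendsto (fun s : ℝ => ‖Q.eval (s:ℂ)‖) (nhdsWithin (0:ℝ) (Ioi 0)) (nhds ‖Q.eval 0‖) := by
      have : Continuous (fun s : ℝ => ‖Q.eval (s:ℂ)‖) :=
        (Q.continuous.comp Complex.continuous_ofReal).norm
      have := this.tendsto 0
      simp only [ofReal_zero] at this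
      exact this.mono_left nhdsWithin_le_nhds
    have hz : Tendsto (fun s : ℝ => |C| * s) (nhdsWithin (0:ℝ) (Ioi 0)) (nhds 0) := by
      have : Continuous (fun s : ℝ => |C| * s) := by fun_prop
      have := this.tendsto 0
      simp only [mul_zero] at this
      exact this.mono_left nhdsWithin_le_nhds
    have hle : ‖Q.eval 0‖ ≤ 0 := by
      refine le_of_tendsto_of_tendsto hc hz ?_
      filter_upwards [h1, hlt] with s hs h0
      rw [Polynomial.eval_mul, Polynomial.eval_pow, Polynomial.eval_X, norm_mul, norm_pow, Complex.norm_real,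
        Real.norm_of_nonneg h0.1.le, pow_succ] at hs
      have : s ^ m * ‖Q.eval (s:ℂ)‖ ≤ s ^ m * (|C| * s) := by linarith
      exact le_of_mul_le_mul_left this (pow_pos h0.1 m)
    exact norm_le_zero_iff.mp hle

/-- the homogeneous part of degree `n` as a polynomial -/
def Qh (p : FormalMultilinearSeries ℂ C4 ℂ) (n : ℕ) : MP :=
  ∑ f : Fin n → Fin 4, MvPolynomial.C (p n (fun i => Pi.single (f i) 1)) * ∏ i, MvPolynomial.X (f i)

lemma Qh_eval (p : FormalMultilinearSeries ℂ C4 ℂ) (n : ℕ) (x : C4) :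
    MvPolynomial.eval x (Qh p n) = p n (fun _ => x) := by
  have hx : x = ∑ j, x j • (Pi.single j (1:ℂ) : C4) := by
    ext k; simp [Finset.sum_apply, Pi.single_apply]
  conv_rhs => rw [hx]
  rw [ContinuousMultilinearMap.map_sum]
  simp only [Qh, map_sum, map_mul, MvPolynomial.eval_C, map_prod, MvPolynomial.eval_X,
    ContinuousMultilinearMap.map_smul_univ, smul_eq_mul]
  exact Finset.sum_congr rfl fun f _ => mul_comm _ _

lemma Qh_hom (p : FormalMultilinearSeries ℂ C4 ℂ) (n : ℕ) : (Qh p n).IsHomogeneous n := by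
  unfold Qh
  refine MvPolynomial.IsHomogeneous.sum _ _ _ fun f _ => ?_
  refine MvPolynomial.IsHomogeneous.C_mul ?_ _
  have := MvPolynomial.IsHomogeneous.prod (Finset.univ : Finset (Fin n))
    (fun i => (MvPolynomial.X (f i) : MP)) (fun _ => 1) (fun i _ => MvPolynomial.isHomogeneous_X _ _)
  simpa using this

lemma degree_le_mw (m : Fin 4 →₀ ℕ) : m.degree ≤ mw m := by
  rw [Finsupp.degree_eq_sum]
  unfold mw
  refine Finset.sum_le_sum fun i _ => ?_
  have : 1 ≤ wt i := by unfold wt; split_ifs <;> omega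
  nlinarith

lemma Qh_coeff (p : FormalMultilinearSeries ℂ C4 ℂ) (n : ℕ) (m : Fin 4 →₀ ℕ) (h : (Qh p n).coeff m ≠ 0) :
    m.degree = n := by
  have := Qh_hom p n h
  rw [← this, Finsupp.degree_eq_weight_one]; rfl

/-- Taylor polynomials -/
def Pt (p : FormalMultilinearSeries ℂ C4 ℂ) (M : ℕ) : MP := ∑ n ∈ Finset.range M, Qh p n

lemma Pt_eval (p : FormalMultilinearSeries ℂ C4 ℂ) (M : ℕ) (x : C4) :
    MvPolynomial.eval x (Pt p M) = p.partialSum M x := by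
  simp [Pt, FormalMultilinearSeries.partialSum, Qh_eval]

/-- weighted curve -/
def curve (q : MP) (v : C4) : Polynomial ℂ :=
  MvPolynomial.aeval (fun i => Polynomial.C (v i) * Polynomial.X ^ wt i) q

lemma curve_eval (q : MP) (v : C4) (s : ℂ) :
    (curve q v).eval s = MvPolynomial.eval (fun i => s ^ wt i * v i) q := by
  unfold curve
  have : ∀ a : Polynomial ℂ, a.eval s = Polynomial.aeval s a := fun a => (congrFun (Polynomial.coe_aeval_eq_eval s) a).symm
  rw [this, MvPolynomial.comp_aeval_apply]
  have e : (fun i => (Polynomial.aeval s) (Polynomial.C (v i) * Polynomial.X ^ wt i) : C4) =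
      fun i => s ^ wt i * v i := by
    ext i; rw [map_mul, map_pow, Polynomial.aeval_C, Polynomial.aeval_X, mul_comm]; rfl
  rw [e]
  exact RingHom.congr_fun (MvPolynomial.coe_aeval_eq_eval _) q

lemma curve_coeff (q : MP) (v : C4) (w : ℕ) :
    (curve q v).coeff w = MvPolynomial.eval v (∑ m ∈ q.support with mw m = w,
      MvPolynomial.monomial m (q.coeff m)) := by
  unfold curve
  rw [MvPolynomial.aeval_def, MvPolynomial.eval₂_eq', Polynomial.finsetSum_coeff, map_sum, Finset.sum_filter]
  refine Finset.sum_congr rfl fun m _ => ?_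
  have : ∏ i, (Polynomial.C (v i) * Polynomial.X ^ wt i) ^ m i
      = Polynomial.C (∏ i, v i ^ m i) * Polynomial.X ^ mw m := by
    simp only [mul_pow, Finset.prod_mul_distrib, ← pow_mul, Finset.prod_pow_eq_pow_sum, mw, map_prod, map_pow]
    congr 2
    exact Finset.sum_congr rfl fun i _ => mul_comm _ _
  rw [this, ← mul_assoc]
  show (Polynomial.C (q.coeff m) * Polynomial.C _ * _).coeff w = _
  rw [← map_mul, Polynomial.coeff_C_mul, Polynomial.coeff_X_pow]
  split_ifs with h1 h2 h2
  · rw [MvPolynomial.eval_monomial]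
    simp [Finsupp.prod_fintype]
  · exact absurd h1.symm h2
  · exact absurd h2.symm h1
  · simp

lemma WOrd_of_curve (q : MP) (w : ℕ) (h : ∀ v, (Polynomial.X : Polynomial ℂ) ^ w ∣ curve q v) : WOrd w q := by
  classical
  intro m hm
  by_contra hlt
  push Not at hlt
  have h0 : (∑ m' ∈ q.support with mw m' = mw m, MvPolynomial.monomial m' (q.coeff m') : MP) = 0 := by
    refine MvPolynomial.funext fun v => ?_
    rw [← curve_coeff, Polynomial.X_pow_dvd_iff.mp (h v) _ hlt]; simp
  have := congrArg (MvPolynomial.coeff m) h0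
  rw [MvPolynomial.coeff_sum] at this
  simp only [MvPolynomial.coeff_monomial, MvPolynomial.coeff_zero] at this
  rw [Finset.sum_ite_eq'] at this
  simp [MvPolynomial.mem_support_iff] at this
  exact hm this

lemma wsize_curve (v : C4) : ∃ K : ℝ, 0 ≤ K ∧ ∀ s : ℝ, 0 < s →
    wsize (fun i => (s:ℂ) ^ wt i * v i) ≤ K * s := by
  refine ⟨wsize v, ?_, fun s hs => ?_⟩
  · exact le_max_of_le_right (le_max_of_le_left (norm_nonneg _))
  · have e : ∀ a : ℂ, ‖(s:ℂ) ^ 2 * a‖ ^ ((1:ℝ)/2) = ‖a‖ ^ ((1:ℝ)/2) * s := by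
      intro a
      rw [norm_mul, norm_pow, Complex.norm_real, Real.norm_of_nonneg hs.le,
        Real.mul_rpow (by positivity) (norm_nonneg _), ← Real.sqrt_eq_rpow, ← Real.sqrt_eq_rpow, Real.sqrt_sq hs.le, mul_comm]
    have e1 : ∀ a : ℂ, ‖(s:ℂ) ^ 1 * a‖ = ‖a‖ * s := by
      intro a
      rw [norm_mul, norm_pow, Complex.norm_real, Real.norm_of_nonneg hs.le, pow_one, mul_comm]
    unfold wsize
    show max (max (‖(s:ℂ) ^ 2 * v 0‖ ^ ((1:ℝ)/2)) (‖(s:ℂ) ^ 2 * v 1‖ ^ ((1:ℝ)/2)))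
      (max ‖(s:ℂ) ^ 1 * v 2‖ ‖(s:ℂ) ^ 1 * v 3‖) ≤ _
    rw [e, e, e1, e1, max_mul_of_nonneg _ _ hs.le, max_mul_of_nonneg _ _ hs.le, max_mul_of_nonneg _ _ hs.le]

lemma curve_tendsto (v : C4) : Tendsto (fun s : ℝ => (fun i => (s:ℂ) ^ wt i * v i : C4))
    (nhdsWithin (0:ℝ) (Ioi 0)) (nhds 0) := by
  have : Continuous (fun s : ℝ => (fun i => (s:ℂ) ^ wt i * v i : C4)) := by fun_prop
  have := this.tendsto 0
  have e : (fun i => ((0:ℝ):ℂ) ^ wt i * v i : C4) = 0 := by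
    ext i
    have : wt i ≠ 0 := by unfold wt; split_ifs <;> omega
    simp [this]
  rw [e] at this
  exact this.mono_left nhdsWithin_le_nhds

lemma WOrd_Pt5 (d : HamData) (p : FormalMultilinearSeries ℂ C4 ℂ) (hp : HasFPowerSeriesAt d.F p 0) :
    WOrd 5 (Pt p 5) := by
  refine WOrd_of_curve _ _ fun v => ?_
  obtain ⟨C, hC⟩ := d.hFord
  obtain ⟨K, hK, hw⟩ := wsize_curve v
  obtain ⟨B, hB⟩ := (hp.isBigO_sub_partialSum_pow 5).bound
  have ht := curve_tendsto v
  have hlt : ∀ᶠ s : ℝ in nhdsWithin (0:ℝ) (Ioi 0), 0 < s ∧ s < 1 := by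
    filter_upwards [Ioo_mem_nhdsGT (zero_lt_one' ℝ)] with s hs using hs
  refine poly_growth _ (|C| * K ^ 5 + |B| * ‖v‖ ^ 5) 5 ?_
  filter_upwards [ht.eventually hB, ht.eventually (d.hopen.mem_nhds d.hzero), hlt] with s h1 h2 h3
  rw [curve_eval, Pt_eval]
  set x : C4 := fun i => (s:ℂ) ^ wt i * v i with hx
  have h4 : ‖x‖ ≤ ‖v‖ * s := by
    refine (pi_norm_le_iff_of_nonneg (by have := h3.1; positivity)).mpr fun i => ?_
    rw [hx]
    simp only [norm_mul, norm_pow, Complex.norm_real, Real.norm_of_nonneg h3.1.le]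
    have h5 : s ^ wt i ≤ s := by
      have : wt i ≠ 0 := by unfold wt; split_ifs <;> omega
      exact pow_le_of_le_one h3.1.le h3.2.le this
    rw [mul_comm]
    exact mul_le_mul (norm_le_pi_norm v i) h5 (pow_nonneg h3.1.le _) (norm_nonneg _)
  have h6 : ‖d.F x‖ ≤ |C| * (K * s) ^ 5 := by
    refine (hC x h2).trans ?_
    have h0 : 0 ≤ wsize x := le_max_of_le_right (le_max_of_le_left (norm_nonneg _))
    exact mul_le_mul (le_abs_self C) (pow_le_pow_left₀ h0 (hw s h3.1) 5) (pow_nonneg h0 _) (abs_nonneg _)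
  have h7 : ‖d.F x - p.partialSum 5 x‖ ≤ |B| * (‖v‖ * s) ^ 5 := by
    rw [zero_add] at h1
    refine h1.trans ?_
    rw [norm_pow, norm_norm]
    exact mul_le_mul (le_abs_self B) (pow_le_pow_left₀ (norm_nonneg _) h4 5) (by positivity) (abs_nonneg _)
  calc ‖p.partialSum 5 x‖ = ‖d.F x - (d.F x - p.partialSum 5 x)‖ := by congr 1; ring
    _ ≤ ‖d.F x‖ + ‖d.F x - p.partialSum 5 x‖ := norm_sub_le _ _
    _ ≤ |C| * (K * s) ^ 5 + |B| * (‖v‖ * s) ^ 5 := add_le_add h6 h7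
    _ = _ := by ring

lemma truncSeq_Pt (d : HamData) (p : FormalMultilinearSeries ℂ C4 ℂ) (hp : HasFPowerSeriesAt d.F p 0) :
    TruncSeq (Pt p) := by
  have h5 := WOrd_Pt5 d p hp
  have hn : ∀ n, WOrd n (Qh p n) := fun n m hm => by
    rw [← Qh_coeff p n m hm]; exact degree_le_mw m
  have hQ : ∀ n, WOrd 5 (Qh p n) := by
    intro n
    by_cases h : 5 ≤ n
    · exact (hn n).mono h
    · intro m hm
      refine h5 m ?_
      have hd := Qh_coeff p n m hm
      unfold Pt
      rw [MvPolynomial.coeff_sum, Finset.sum_eq_single n]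
      · exact hm
      · intro b _ hb
        by_contra hc
        exact hb ((Qh_coeff p b m hc).symm.trans hd)
      · intro hc; simp at hc; omega
  refine ⟨fun M => WOrd.sum _ _ fun n _ => hQ n, fun M M' h => ?_⟩
  unfold Pt
  rw [← Finset.sum_range_add_sum_Ico _ h, add_sub_cancel_left]
  refine WOrd.sum _ _ fun n hmem => (hn n).mono (Finset.mem_Ico.mp hmem).1


/-! ## Gradient of the remainder -/

lemma fderiv_mvEval (q : MP) (x : C4) (i : Fin 4) :
    DifferentiableAt ℂ (fun y : C4 => MvPolynomial.eval y q) x ∧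
    fderiv ℂ (fun y : C4 => MvPolynomial.eval y q) x (Pi.single i 1)
      = MvPolynomial.eval x (MvPolynomial.pderiv i q) := by
  induction q using MvPolynomial.induction_on with
  | C a => simp
  | add p q hp hq =>
    simp only [map_add]
    refine ⟨hp.1.add hq.1, ?_⟩
    rw [fderiv_fun_add hp.1 hq.1, ContinuousLinearMap.add_apply, hp.2, hq.2]
  | mul_X p j hp =>
    have hj : HasFDerivAt (fun y : C4 => y j) (ContinuousLinearMap.proj (R := ℂ) (φ := fun _ : Fin 4 => ℂ) j) x :=
      hasFDerivAt_apply j x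
    simp only [map_mul, MvPolynomial.eval_X]
    refine ⟨hp.1.mul hj.differentiableAt, ?_⟩
    rw [fderiv_fun_mul hp.1 hj.differentiableAt, hj.fderiv]
    simp only [ContinuousLinearMap.add_apply, ContinuousLinearMap.smul_apply, hp.2, smul_eq_mul,
      MvPolynomial.pderiv_mul, map_add, map_mul, MvPolynomial.eval_X, MvPolynomial.pderiv_X,
      ContinuousLinearMap.proj_apply]
    by_cases h : i = j
    · subst h; simp; ring
    · simp [Pi.single_apply, h, Ne.symm h]; ring

lemma grad_bound (E : C4 → ℂ) (ρ C : ℝ) (M : ℕ) (hC : 0 ≤ C)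
    (hd : ∀ y, ‖y‖ < ρ → DifferentiableAt ℂ E y) (hE : ∀ y, ‖y‖ < ρ → ‖E y‖ ≤ C * ‖y‖ ^ (M+1))
    (r : ℝ) (hr : 0 < r) (hρ : 2 * r < ρ) (x : C4) (hx : ‖x‖ ≤ r) (i : Fin 4) :
    ‖fderiv ℂ E x (Pi.single i 1)‖ ≤ C * 2 ^ (M+1) * r ^ M := by
  set v : C4 := Pi.single i 1 with hv
  have hv1 : ‖v‖ ≤ 1 := by
    refine (pi_norm_le_iff_of_nonneg zero_le_one).mpr fun j => ?_
    rw [hv, Pi.single_apply]; split_ifs <;> simp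
  have hn : ∀ s : ℂ, ‖s‖ ≤ r → ‖x + s • v‖ ≤ 2 * r := by
    intro s hs
    have h1 : ‖s • v‖ ≤ r * 1 := by
      rw [norm_smul]; exact mul_le_mul hs hv1 (norm_nonneg _) hr.le
    linarith [norm_add_le x (s • v)]
  have hl : ∀ s : ℂ, HasDerivAt (fun s : ℂ => x + s • v) v s := by
    intro s
    have := ((hasDerivAt_id s).smul_const v).const_add x
    simpa using this
  have hg : ∀ s : ℂ, ‖s‖ ≤ r → HasDerivAt (fun s : ℂ => E (x + s • v)) (fderiv ℂ E (x + s • v) v) s := by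
    intro s hs
    exact (hd _ ((hn s hs).trans_lt hρ)).hasFDerivAt.comp_hasDerivAt s (hl s)
  have h0 := hg 0 (by simpa using hr.le)
  have hb := Complex.norm_deriv_le_of_forall_mem_sphere_norm_le (c := 0) (R := r) (C := C * (2 * r) ^ (M+1))
    (f := fun s : ℂ => E (x + s • v)) hr ?_ ?_
  · rw [h0.deriv] at hb
    simp only [zero_smul, add_zero] at hb
    refine hb.trans (le_of_eq ?_)
    rw [div_eq_iff hr.ne', mul_pow]; ring
  · apply DifferentiableOn.diffContOnCl
    rw [closure_ball 0 hr.ne']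
    intro s hs
    exact (hg s (by simpa using hs)).differentiableAt.differentiableWithinAt
  · intro s hs
    have hs' : ‖s‖ ≤ r := by simp at hs; exact hs.le
    refine (hE _ ((hn s hs').trans_lt hρ)).trans ?_
    exact mul_le_mul_of_nonneg_left (pow_le_pow_left₀ (norm_nonneg _) (hn s hs') _) hC

/-- polynomial part of the Hamiltonian -/
def h0p (η : ℂ) : MP :=
  -(MvPolynomial.X 1 * MvPolynomial.X 2 - MvPolynomial.X 0 * MvPolynomial.X 3)
  + MvPolynomial.C (1/2) * (MvPolynomial.X 0 ^ 2 + MvPolynomial.X 1 ^ 2)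
  + MvPolynomial.C (η/4) * (MvPolynomial.X 2 ^ 2 + MvPolynomial.X 3 ^ 2) ^ 2

lemma Yv_eval (η : ℂ) (P : MP) (x : C4) (i : Fin 4) :
    MvPolynomial.eval x (Yv η P i)
      = Jmat.mulVec (fun j => MvPolynomial.eval x (MvPolynomial.pderiv j (h0p η + P))) i := by
  fin_cases i <;>
  simp [Yv, Jmat, h0p, Matrix.mulVec, dotProduct, Fin.sum_univ_four, MvPolynomial.pderiv_X, Pi.single_apply,
    MvPolynomial.pderiv_mul, MvPolynomial.pderiv_pow] <;> ring

lemma Ham_split (d : HamData) (P : MP) : Ham d = fun x => MvPolynomial.eval x (h0p d.η + P)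
    + (d.F x - MvPolynomial.eval x P) := by
  funext x
  simp [Ham, h0p, I1f, I2f, I3f]
  ring

lemma Jmat_bound (a b : C4) (B : ℝ) (h : ∀ j, ‖a j - b j‖ ≤ B) (i : Fin 4) :
    ‖Jmat.mulVec a i - Jmat.mulVec b i‖ ≤ B := by
  have h0 := h 0
  have h1 := h 1
  have h2 := h 2
  have h3 := h 3
  have e : ∀ u v : ℂ, -u - -v = -(u - v) := fun u v => by ring
  fin_cases i <;> simp [Jmat, Matrix.mulVec, dotProduct, Fin.sum_univ_four, h2, h3] <;>
    rw [neg_add_eq_sub, norm_sub_rev] <;> assumption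

lemma XH_rem (d : HamData) (p : FormalMultilinearSeries ℂ C4 ℂ) (hp : HasFPowerSeriesAt d.F p 0) (M : ℕ) :
    ∃ ρ > (0:ℝ), ∃ C ≥ (0:ℝ), ∀ r, 0 < r → r < ρ → ∀ x : C4, ‖x‖ ≤ r → x ∈ d.dom ∧
      ∀ i, ‖XH (Ham d) x i - MvPolynomial.eval x (Yv d.η (Pt p (M+1)) i)‖ ≤ C * r ^ M := by
  obtain ⟨B, hB⟩ := (hp.isBigO_sub_partialSum_pow (M+1)).bound
  have hev := hB.and (d.hopen.mem_nhds d.hzero)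
  obtain ⟨ρ, hρ, hball⟩ := Metric.eventually_nhds_iff_ball.mp hev
  have hb : ∀ y : C4, ‖y‖ < ρ → ‖d.F y - MvPolynomial.eval y (Pt p (M+1))‖ ≤ |B| * ‖y‖ ^ (M+1) ∧ y ∈ d.dom := by
    intro y hy
    obtain ⟨h1, h2⟩ := hball y (by simpa using hy)
    refine ⟨?_, h2⟩
    rw [zero_add, norm_pow, norm_norm] at h1
    rw [Pt_eval]
    exact h1.trans (mul_le_mul_of_nonneg_right (le_abs_self B) (by positivity))
  have hdiff : ∀ y : C4, ‖y‖ < ρ → DifferentiableAt ℂ (fun y => d.F y - MvPolynomial.eval y (Pt p (M+1))) y := by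
    intro y hy
    exact (d.hFan y (hb y hy).2).differentiableAt.sub (fderiv_mvEval _ y 0).1
  refine ⟨ρ/2, by positivity, |B| * 2 ^ (M+1), by positivity, fun r hr hr2 x hx => ?_⟩
  have hxρ : ‖x‖ < ρ := by linarith
  refine ⟨(hb x hxρ).2, fun i => ?_⟩
  rw [Yv_eval]
  refine Jmat_bound _ _ _ (fun j => ?_) i
  unfold gradC
  rw [Ham_split d (Pt p (M+1)), fderiv_fun_add (fderiv_mvEval _ x 0).1 (hdiff x hxρ), ContinuousLinearMap.add_apply,
    (fderiv_mvEval _ x j).2, add_sub_cancel_left]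
  exact grad_bound _ ρ |B| M (abs_nonneg B) hdiff (fun y hy => (hb y hy).1) r hr (by linarith) x hx j


/-! ## Bridge between formal series and asymptotic estimates -/

/-- evaluation of polynomials in `s = 1/t` with trigonometric coefficients -/
def evp (φ t : ℂ) : Polynomial LA →ₐ[ℂ] ℂ :=
  { Polynomial.eval₂RingHom (ev φ).toRingHom t⁻¹ with
    commutes' := fun r => by
      show Polynomial.eval₂ (ev φ).toRingHom t⁻¹ (algebraMap ℂ (Polynomial LA) r) = _
      rw [Polynomial.algebraMap_apply, Polynomial.eval₂_C]
      exact (ev φ).commutes r }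

lemma nrm_tri (a b : ℂ) : ‖a‖ ≤ ‖b‖ + ‖b - a‖ := by
  have := norm_sub_le b (b - a)
  rwa [sub_sub_cancel] at this

lemma evp_eq (φ t : ℂ) (q : Polynomial LA) : evp φ t q = (q.map (ev φ).toRingHom).eval t⁻¹ := by
  rw [Polynomial.eval_map]; rfl

lemma evp_monomial (φ t : ℂ) (k : ℕ) (a : LA) : evp φ t (Polynomial.monomial k a) = ev φ a * t ^ (-(k:ℤ)) := by
  rw [evp_eq, Polynomial.map_monomial, Polynomial.eval_monomial, _root_.zpow_neg, zpow_natCast, inv_pow]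
  rfl

/-- coercion to formal series -/
def cS : Polynomial LA →ₐ[ℂ] RR :=
  { Polynomial.coeToPowerSeries.ringHom with
    commutes' := fun r => by
      show ((algebraMap ℂ (Polynomial LA) r : Polynomial LA) : RR) = _
      rw [Polynomial.algebraMap_apply, Polynomial.coe_C]; exact (PowerSeries.algebraMap_apply).symm }

lemma cS_coeff (q : Polynomial LA) (k : ℕ) : PowerSeries.coeff k (cS q) = q.coeff k :=
  Polynomial.coeff_coe q k

lemma cS_dvd (q : Polynomial LA) (m : ℕ) : sX ^ m ∣ cS q ↔ (Polynomial.X : Polynomial LA) ^ m ∣ q := by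
  rw [PowerSeries.X_pow_dvd_iff, Polynomial.X_pow_dvd_iff]
  simp only [cS_coeff]

lemma evp_bound (q : Polynomial LA) : ∃ C : ℝ, 0 ≤ C ∧ ∀ φ t : ℝ, 1 ≤ t → ‖evp φ t q‖ ≤ C := by
  induction q using Polynomial.induction_on' with
  | add p q hp hq =>
    obtain ⟨A, hA, h1⟩ := hp
    obtain ⟨B, hB, h2⟩ := hq
    refine ⟨A + B, by positivity, fun φ t ht => ?_⟩
    rw [map_add]
    exact (norm_add_le _ _).trans (add_le_add (h1 φ t ht) (h2 φ t ht))
  | monomial k a =>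
    obtain ⟨B, hB, h⟩ := ev_bound a
    refine ⟨B, hB, fun φ t ht => ?_⟩
    rw [evp_monomial, norm_mul, _root_.zpow_neg, zpow_natCast, norm_inv, norm_pow, Complex.norm_real,
      Real.norm_of_nonneg (by linarith)]
    have : (t ^ k)⁻¹ ≤ 1 := inv_le_one_of_one_le₀ (one_le_pow₀ ht)
    calc _ ≤ B * 1 := mul_le_mul (h φ) this (by positivity) hB
      _ = B := mul_one B

lemma evp_bound_of_dvd (q : Polynomial LA) (m : ℕ) (h : sX ^ m ∣ cS q) :
    ∃ C : ℝ, 0 ≤ C ∧ ∀ φ t : ℝ, 1 ≤ t → ‖evp φ t q‖ ≤ C / t ^ m := by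
  rw [cS_dvd] at h
  obtain ⟨r, rfl⟩ := h
  obtain ⟨C, hC, hb⟩ := evp_bound r
  refine ⟨C, hC, fun φ t ht => ?_⟩
  have e : evp φ t (Polynomial.X : Polynomial LA) = (t:ℂ)⁻¹ := by
    rw [evp_eq]; simp
  rw [map_mul, map_pow, e, norm_mul, norm_pow, norm_inv, Complex.norm_real,
      Real.norm_of_nonneg (by linarith), inv_pow, div_eq_inv_mul]
  exact mul_le_mul_of_nonneg_left (hb φ t ht) (by positivity)

lemma dvd_of_evp_bound (q : Polynomial LA) (m : ℕ) (C T : ℝ)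
    (h : ∀ φ t : ℝ, T ≤ t → ‖evp φ t q‖ ≤ C / t ^ m) : sX ^ m ∣ cS q := by
  rw [cS_dvd, Polynomial.X_pow_dvd_iff]
  intro k hk
  refine ev_eq_zero _ fun φ => ?_
  have hg := poly_growth (q.map (ev (φ:ℂ)).toRingHom) C m ?_
  · have := Polynomial.X_pow_dvd_iff.mp hg k hk
    rwa [Polynomial.coeff_map] at this
  · have hlt : ∀ᶠ s : ℝ in nhdsWithin (0:ℝ) (Ioi 0), 0 < s ∧ s < (|T| + 1)⁻¹ := by
      filter_upwards [Ioo_mem_nhdsGT (show (0:ℝ) < (|T| + 1)⁻¹ by positivity)] with s hs using hs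
    filter_upwards [hlt] with s hs
    have hT : T ≤ s⁻¹ := by
      have : |T| + 1 ≤ s⁻¹ := by
        rw [le_inv_comm₀ (by positivity) hs.1]; exact hs.2.le
      linarith [le_abs_self T]
    have := h φ s⁻¹ hT
    rw [evp_eq, ofReal_inv, inv_inv, inv_pow, div_inv_eq_mul] at this
    exact this

/-- truncations -/
def tN (a : ℕ → LA) (n : ℕ) : Polynomial LA := ∑ k ∈ Finset.range n, Polynomial.monomial k (a k)

def dN (a : ℕ → LA) (n : ℕ) : Polynomial LA := ∑ k ∈ Finset.range n,
  (Polynomial.monomial k (dph (a k)) - Polynomial.monomial (k + 1) ((k:ℂ) • a k))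

lemma cS_mon (k : ℕ) (a : LA) : cS (Polynomial.monomial k a) = sX ^ k * PowerSeries.C a := by
  ext1 m
  rw [cS_coeff, coeff_XC, Polynomial.coeff_monomial]
  simp only [eq_comm]

lemma cS_dN (a : ℕ → LA) (n : ℕ) : cS (dN a n) = DD (cS (tN a n)) := by
  unfold dN tN
  simp only [map_sum, map_sub, cS_mon]
  refine Finset.sum_congr rfl fun k _ => ?_
  rcases Nat.eq_zero_or_pos k with rfl | hk
  · ext1 m
    cases m with
    | zero => rw [DD_coeff_zero, map_sub]; simp only [coeff_XC]; simp
    | succ m =>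
      rw [DD_coeff_succ, map_sub]; simp only [coeff_XC]
      by_cases h : m = 0 <;> simp [h]
  · rw [DD_mon k hk]

lemma cS_tN_dvd (f : RR) (n : ℕ) : sX ^ n ∣ cS (tN (fun k => PowerSeries.coeff k f) n) - f := by
  rw [PowerSeries.X_pow_dvd_iff]
  intro m hm
  rw [map_sub, cS_coeff, tN, Polynomial.finsetSum_coeff]
  simp only [Polynomial.coeff_monomial]
  rw [Finset.sum_ite_eq' ]
  simp [hm]

lemma evp_tN (a : ℕ → LA) (n : ℕ) (φ t : ℂ) :
    evp φ t (tN a n) = ∑ k ∈ Finset.range n, ev φ (a k) * t ^ (-(k:ℤ)) := by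
  simp only [tN, map_sum, evp_monomial]

lemma evp_dN (a : ℕ → LA) (n : ℕ) (φ t : ℂ) (ht : t ≠ 0) :
    evp φ t (dN a n) = deriv (fun x => ∑ k ∈ Finset.range n, ev x (a k) * t ^ (-(k:ℤ))) φ
      + deriv (fun x => ∑ k ∈ Finset.range n, ev φ (a k) * x ^ (-(k:ℤ))) t := by
  have h1 : HasDerivAt (fun x => ∑ k ∈ Finset.range n, ev x (a k) * t ^ (-(k:ℤ)))
      (∑ k ∈ Finset.range n, ev φ (dph (a k)) * t ^ (-(k:ℤ))) φ :=
    HasDerivAt.fun_sum fun k _ => (hasDerivAt_ev (a k) φ).mul_const _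
  have h2 : HasDerivAt (fun x => ∑ k ∈ Finset.range n, ev φ (a k) * x ^ (-(k:ℤ)))
      (∑ k ∈ Finset.range n, ev φ (a k) * (((-(k:ℤ) : ℤ) : ℂ) * t ^ (-(k:ℤ) - 1))) t :=
    HasDerivAt.fun_sum fun k _ => (hasDerivAt_zpow (-(k:ℤ)) t (Or.inl ht)).const_mul _
  rw [h1.deriv, h2.deriv, ← Finset.sum_add_distrib]
  simp only [dN, map_sum, map_sub, evp_monomial]
  refine Finset.sum_congr rfl fun k _ => ?_
  have : (-((k + 1 : ℕ) : ℤ)) = -(k:ℤ) - 1 := by push_cast; ring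
  rw [this, map_smul, smul_eq_mul]
  push_cast
  ring

/-- coefficient functions of a formal series -/
def Gof (x : Fin 4 → RR) : ℕ → ℂ → C4 := fun k φ i => ev φ (PowerSeries.coeff k (x i))

def xN (x : Fin 4 → RR) (N : ℕ) (i : Fin 4) : Polynomial LA := tN (fun k => PowerSeries.coeff k (x i)) (N + wt i)

def rhoN (η : ℂ) (P : MP) (x : Fin 4 → RR) (N : ℕ) (i : Fin 4) : Polynomial LA :=
  dN (fun k => PowerSeries.coeff k (x i)) (N + wt i) - MvPolynomial.aeval (xN x N) (Yv η P i)

lemma cS_rhoN (η : ℂ) (P : MP) (x : Fin 4 → RR) (N : ℕ) (i : Fin 4) :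
    cS (rhoN η P x N i) = Res η P (fun j => cS (xN x N j)) i := by
  unfold rhoN Res
  rw [map_sub, cS_dN, MvPolynomial.comp_aeval_apply]
  rfl

lemma evp_xN (x : Fin 4 → RR) (N : ℕ) (φ t : ℂ) :
    (fun i => evp φ t (xN x N i)) = pSum (Gof x) N φ t := by
  funext i
  unfold xN pSum
  rw [evp_tN, psOrd_succ]
  rfl

lemma evp_rhoN (η : ℂ) (P : MP) (x : Fin 4 → RR) (N : ℕ) (i : Fin 4) (φ t : ℂ) (ht : t ≠ 0) :
    evp φ t (rhoN η P x N i) = DopV (pSum (Gof x) N) φ t i - MvPolynomial.eval (pSum (Gof x) N φ t) (Yv η P i) := by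
  unfold rhoN
  rw [map_sub, MvPolynomial.comp_aeval_apply, evp_dN _ _ _ _ ht, evp_xN]
  congr 1
  · unfold DopV pSum
    simp only [psOrd_succ]
    rfl

lemma rhoN_dvd (η : ℂ) {P : MP} (hP : WOrd 5 P) {x : Fin 4 → RR} (hx : SS 0 x) (N : ℕ) :
    SS N (fun i => cS (rhoN η P x N i)) ↔ SS N (Res η P x) := by
  have h : SS N ((fun j => cS (xN x N j)) - x) := fun i => cS_tN_dvd (x i) _
  have h' := Res_sub_dvd η hP hx h
  unfold SS
  refine forall_congr' fun i => ?_
  show sX ^ (N + wt i) ∣ cS (rhoN η P x N i) ↔ _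
  rw [cS_rhoN]
  exact dvd_iff_dvd_of_dvd_sub (h' i)

lemma wt_pos (i : Fin 4) : 1 ≤ wt i := by unfold wt; split_ifs <;> omega
lemma wt_le (i : Fin 4) : wt i ≤ 2 := by unfold wt; split_ifs <;> omega

lemma pSum_bound {x : Fin 4 → RR} (hx : SS 0 x) (N : ℕ) :
    ∃ K > (0:ℝ), ∀ φ t : ℝ, 1 ≤ t → ‖pSum (Gof x) N φ t‖ ≤ K / t := by
  have h : ∀ i, ∃ C : ℝ, 0 ≤ C ∧ ∀ φ t : ℝ, 1 ≤ t → ‖evp φ t (xN x N i)‖ ≤ C / t ^ 1 := by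
    intro i
    refine evp_bound_of_dvd _ _ ?_
    have h1 : sX ^ 1 ∣ x i := (pow_dvd_pow _ (by have := wt_pos i; omega)).trans (hx i)
    have h2 := (pow_dvd_pow sX (by have := wt_pos i; omega : 1 ≤ N + wt i)).trans (cS_tN_dvd (x i) (N + wt i))
    exact (dvd_iff_dvd_of_dvd_sub h2).mpr h1
  choose C hC hb using h
  have hs : 0 ≤ ∑ i, C i := Finset.sum_nonneg fun i _ => hC i
  refine ⟨∑ i, C i + 1, by positivity, fun φ t ht => ?_⟩
  have ht0 : 0 < t := by linarith
  refine (pi_norm_le_iff_of_nonneg (by positivity)).mpr fun i => ?_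
  rw [← evp_xN]
  refine (hb i φ t ht).trans ?_
  rw [pow_one]
  refine div_le_div_of_nonneg_right ?_ ht0.le
  have := Finset.single_le_sum (fun j _ => hC j) (Finset.mem_univ i)
  linarith

lemma bridge (d : HamData) (p : FormalMultilinearSeries ℂ C4 ℂ) (hp : HasFPowerSeriesAt d.F p 0)
    {x : Fin 4 → RR} (hx : SS 0 x) (N : ℕ) :
    ∃ K ≥ (0:ℝ), ∃ T ≥ (1:ℝ), ∀ φ t : ℝ, T ≤ t → pSum (Gof x) N φ t ∈ d.dom ∧
      ∀ i, ‖evp φ t (rhoN d.η (Pt p (N+5)) x N i)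
        - (DopV (pSum (Gof x) N) φ t i - XH (Ham d) (pSum (Gof x) N φ t) i)‖ ≤ K / t ^ (N + wt i) := by
  obtain ⟨K, hK, hb⟩ := pSum_bound hx N
  obtain ⟨ρ, hρ, C, hC, h⟩ := XH_rem d p hp (N+4)
  refine ⟨C * K ^ (N+4), by positivity, 1 + 2 * K / ρ, by have := div_pos (mul_pos two_pos hK) hρ; linarith, fun φ t ht => ?_⟩
  have h1 : 0 < 2 * K / ρ := by positivity
  have ht1 : 1 ≤ t := by linarith
  have ht0 : 0 < t := by linarith
  have hr : K / t < ρ := by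
    rw [div_lt_iff₀ ht0]
    have : 2 * K / ρ ≤ t := by linarith
    rw [div_le_iff₀ hρ] at this
    linarith
  obtain ⟨hdom, hres⟩ := h (K / t) (by positivity) hr _ (hb φ t ht1)
  refine ⟨hdom, fun i => ?_⟩
  rw [evp_rhoN _ _ _ _ _ _ _ (by exact_mod_cast ht0.ne')]
  rw [sub_sub_sub_cancel_left]
  refine (hres i).trans ?_
  rw [div_pow, ← mul_div_assoc]
  refine div_le_div_of_nonneg_left (by positivity) (by positivity) ?_
  exact pow_le_pow_right₀ ht1 (by have := wt_le i; omega)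

lemma FS_iff (d : HamData) (p : FormalMultilinearSeries ℂ C4 ℂ) (hp : HasFPowerSeriesAt d.F p 0)
    {x : Fin 4 → RR} (hx : SS 0 x) : FS d.η (Pt p) x ↔
    ∀ N : ℕ, ∃ C > (0:ℝ), ∃ T > (0:ℝ), ∀ φ t : ℝ, T ≤ t →
    pSum (Gof x) N (φ:ℂ) (t:ℂ) ∈ d.dom ∧
    ∀ i : Fin 4,
      ‖DopV (pSum (Gof x) N) (φ:ℂ) (t:ℂ) i - XH (Ham d) (pSum (Gof x) N (φ:ℂ) (t:ℂ)) i‖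
        ≤ C / t ^ (psOrd N i + 1) := by
  have hP := truncSeq_Pt d p hp
  constructor
  · rintro ⟨-, hF⟩ N
    have hr := (rhoN_dvd d.η (hP.five (N+5)) hx N).mpr (hF N (N+5) (by omega))
    have hb := fun i => evp_bound_of_dvd _ _ (hr i)
    choose B hB hb using hb
    obtain ⟨K, hK, T, hT, h⟩ := bridge d p hp hx N
    have hs : 0 ≤ ∑ i, B i := Finset.sum_nonneg fun i _ => hB i
    refine ⟨∑ i, B i + K + 1, by positivity, T, by linarith, fun φ t ht => ?_⟩
    obtain ⟨h1, h2⟩ := h φ t ht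
    refine ⟨h1, fun i => ?_⟩
    have h3 := h2 i
    have h4 := hb i φ t (by linarith)
    have ht0 : 0 < t := by linarith
    rw [psOrd_succ]
    have h5 := nrm_tri (DopV (pSum (Gof x) N) φ t i - XH (Ham d) (pSum (Gof x) N φ t) i)
      (evp φ t (rhoN d.η (Pt p (N+5)) x N i))
    have h6 : B i / t ^ (N + wt i) + K / t ^ (N + wt i) ≤ (∑ i, B i + K + 1) / t ^ (N + wt i) := by
      rw [← add_div]
      refine div_le_div_of_nonneg_right ?_ (by positivity)
      have := Finset.single_le_sum (fun j _ => hB j) (Finset.mem_univ i)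
      linarith
    linarith
  · intro hF
    refine ⟨hx, fun N M hM => ?_⟩
    refine Res_change d.η hP hx (M := N + 5) (by omega) hM ?_
    rw [← rhoN_dvd d.η (hP.five (N+5)) hx N]
    intro i
    obtain ⟨K, hK, T, hT, h⟩ := bridge d p hp hx N
    obtain ⟨C, hC, T', hT', h'⟩ := hF N
    refine dvd_of_evp_bound _ _ (C + K) (max T T') fun φ t ht => ?_
    have h1 := (h φ t ((le_max_left _ _).trans ht)).2 i
    have h2 := (h' φ t ((le_max_right _ _).trans ht)).2 i
    rw [psOrd_succ] at h2
    rw [add_div]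
    have h5 := nrm_tri (evp φ t (rhoN d.η (Pt p (N+5)) x N i))
      (DopV (pSum (Gof x) N) φ t i - XH (Ham d) (pSum (Gof x) N φ t) i)
    rw [norm_sub_rev _ (evp φ t _)] at h5
    linarith


/-! ## Final assembly -/

lemma SS_zero_iff (x : Fin 4 → RR) : SS 0 x ↔
    (∀ φ, Gof x 0 φ = 0) ∧ (∀ φ, Gof x 1 φ 0 = 0 ∧ Gof x 1 φ 1 = 0) := by
  constructor
  · intro h
    have hz : ∀ i k φ, k < wt i → Gof x k φ i = 0 := by
      intro i k φ hk
      have := coeff_zero_of_dvd (h i) (by omega : k < 0 + wt i)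
      simp [Gof, this]
    exact ⟨fun φ => funext fun i => hz i 0 φ (wt_pos i), fun φ => ⟨hz 0 1 φ (by decide), hz 1 1 φ (by decide)⟩⟩
  · rintro ⟨h0, h1⟩ i
    rw [PowerSeries.X_pow_dvd_iff]
    intro m hm
    refine ev_eq_zero _ fun φ => ?_
    have hm2 : m < 2 := by have := wt_le i; omega
    interval_cases m
    · exact congrFun (h0 φ) i
    · fin_cases i
      · exact (h1 φ).1
      · exact (h1 φ).2
      · exact absurd hm (by decide)
      · exact absurd hm (by decide)

lemma isFormalSol_iff (d : HamData) (p : FormalMultilinearSeries ℂ C4 ℂ) (hp : HasFPowerSeriesAt d.F p 0)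
    (x : Fin 4 → RR) : IsFormalSol d.dom (Ham d) (Gof x) ↔ FS d.η (Pt p) x := by
  constructor
  · rintro ⟨-, h0, h1, h⟩
    have hx := (SS_zero_iff x).mpr ⟨h0, h1⟩
    exact (FS_iff d p hp hx).mpr h
  · intro h
    obtain ⟨h0, h1⟩ := (SS_zero_iff x).mp h.1
    exact ⟨fun k i => isTrigPoly_ev _, h0, h1, (FS_iff d p hp h.1).mp h⟩

lemma Gof_shx (x : Fin 4 → RR) (φ₀ τ₀ : ℂ) : Gof (shx φ₀ τ₀ x) = shiftC (Gof x) φ₀ τ₀ := by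
  funext k φ i
  unfold Gof shx shiftC
  simp only [sig_coeff, map_sum, map_smul, ev_rot, Finset.sum_apply, Pi.smul_apply]
  refine Finset.sum_congr rfl fun j hj => ?_
  have hjk : j ≤ k := by have := Finset.mem_range.mp hj; omega
  rw [sc_eq _ _ _ hjk]

lemma exists_Gof (G : ℕ → ℂ → C4) (h : ∀ k i, IsTrigPoly (fun φ => G k φ i)) : ∃ x, G = Gof x := by
  choose g hg using fun k i => trig_of_isTrigPoly (h k i)
  refine ⟨fun i => PowerSeries.mk fun k => g k i, ?_⟩
  funext k φ i
  simp only [Gof, PowerSeries.coeff_mk]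
  exact hg k i φ

lemma Gof_lead (κ : ℂ) (x : Fin 4 → RR) (h : SS 1 (x - x1 κ)) (i : Fin 4) (φ : ℂ) :
    Gof x (wt i) φ i = κ * ev φ (trg i) := by
  have h1 : PowerSeries.coeff (wt i) (x i) = PowerSeries.coeff (wt i) (x1 κ i) := by
    have := coeff_zero_of_dvd (h i) (by omega : wt i < 1 + wt i)
    rw [Pi.sub_apply, map_sub] at this
    exact sub_eq_zero.mp this
  unfold Gof
  rw [h1, x1_eq, coeff_XC, if_pos rfl, map_mul, ev_C]

theorem statement0 (d : HamData) :
    ∃ (κ : ℂ) (G : ℕ → ℂ → C4),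
      IsFormalSeparatrix d.η d.dom (Ham d) κ G ∧
      ∀ G' : ℕ → ℂ → C4, IsFormalSol d.dom (Ham d) G' → (∃ k φ, G' k φ ≠ 0) →
        ∃ φ₀ τ₀ : ℂ, ∀ k φ, G' k φ = shiftC G φ₀ τ₀ k φ := by
  obtain ⟨p, hp⟩ := d.hFan 0 d.hzero
  obtain ⟨κ, hκ⟩ := IsAlgClosed.exists_pow_nat_eq (-2 / d.η) (n := 2) (by norm_num)
  have hη := d.hη
  have hκ' : d.η * κ ^ 2 = -2 := by rw [hκ]; field_simp
  have hκ0 : κ ≠ 0 := by rintro rfl; norm_num at hκ'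
  have hP := truncSeq_Pt d p hp
  obtain ⟨x, hx, hx1⟩ := exists_formal d.η κ hκ' hP
  have hl := Gof_lead κ x hx1
  refine ⟨κ, Gof x, ⟨hκ, (isFormalSol_iff d p hp x).mpr hx, fun φ => ⟨?_, ?_, ?_, ?_⟩, 1, 0, ?_⟩, ?_⟩
  · rw [← ev_lcos]; exact hl 0 φ
  · rw [← ev_lsin]; exact hl 1 φ
  · rw [← ev_lcos]; exact hl 2 φ
  · rw [← ev_lsin]; exact hl 3 φ
  · intro h
    have h2 : Gof x 1 0 2 = κ * ev 0 lcos := hl 2 0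
    rw [ev_lcos, Complex.cos_zero, mul_one, h] at h2
    exact hκ0 h2.symm
  · rintro G' hG' ⟨k, φ, hne⟩
    obtain ⟨y, rfl⟩ := exists_Gof G' hG'.1
    have hy := (isFormalSol_iff d p hp y).mp hG'
    have hy0 : y ≠ 0 := by
      rintro rfl
      apply hne
      funext i
      simp [Gof]
    obtain ⟨φ₀, τ₀, e⟩ := formal_unique hκ' hP hx hx1 hy hy0
    refine ⟨φ₀, τ₀, fun k φ => ?_⟩
    rw [e, Gof_shx]
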